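/- arXiv:1507.08714 — 4 statements merged into one kernel-verified Lean document; each statement's English description precedes it below -/
import Mathlib

section
/- Let 2 ≤ p < ∞ and let Ω ⊂ ℝⁿ (n ≥ 2) be a bounded domain. Let h be continuous on P_∞, given by h(x,0) = f(x) on cl(Ω) and h(x,t) = g(x,t) on ∂Ω×(0,∞), with h ≥ 0 and sup_{P_∞} h < ∞. Suppose u is upper semicontinuous on Ω_∞ ∪ P_∞, u ≥ 0, u is a viscosity subsolution of Γ_p u = 0 in Ω_∞, and u ≤ h on P_∞. If lim_{t→∞} (sup_{x∈∂Ω} g(x,t)) = 0, then lim_{t→∞} (sup_{Ω×[t,∞)} u) = 0. -/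
open Set Filter
open scoped Classical

/-- The p-Laplacian of a C² test function, in the form used in viscosity solution theory:
`Δ_p φ = |Dφ|^{p-2} tr(D²φ) + (p-2)|Dφ|^{p-4} ⟨D²φ Dφ, Dφ⟩`, set to `0` when `Dφ = 0` and
`p ≠ 2`, and to `tr(D²φ)` when `p = 2`. -/
noncomputable def pLap (n : ℕ) (p : ℝ) (φ : EuclideanSpace ℝ (Fin n) → ℝ)
    (x : EuclideanSpace ℝ (Fin n)) : ℝ :=
  if gradient φ x = 0 then
    if p = 2 then
      ∑ i : Fin n, iteratedFDeriv ℝ 2 φ x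
        ![EuclideanSpace.single i (1 : ℝ), EuclideanSpace.single i (1 : ℝ)]
    else 0
  else
    ‖gradient φ x‖ ^ (p - 2) *
        ∑ i : Fin n, iteratedFDeriv ℝ 2 φ x
          ![EuclideanSpace.single i (1 : ℝ), EuclideanSpace.single i (1 : ℝ)] +
      (p - 2) * ‖gradient φ x‖ ^ (p - 4) *
        iteratedFDeriv ℝ 2 φ x ![gradient φ x, gradient φ x]

/-- The infinity-Laplacian `Δ_∞ φ = ⟨D²φ Dφ, Dφ⟩` of a C² test function. -/
noncomputable def infLap (n : ℕ) (φ : EuclideanSpace ℝ (Fin n) → ℝ)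
    (x : EuclideanSpace ℝ (Fin n)) : ℝ :=
  iteratedFDeriv ℝ 2 φ x ![gradient φ x, gradient φ x]

/-- Parabolic test functions: C² in the space variable and C¹ in the time variable. -/
def ParaTestFn (n : ℕ) (ψ : EuclideanSpace ℝ (Fin n) × ℝ → ℝ) : Prop :=
  (∀ t : ℝ, ContDiff ℝ 2 fun x => ψ (x, t)) ∧ ∀ x, ContDiff ℝ 1 fun t => ψ (x, t)

/-- The p-Laplacian in the space variable of a parabolic test function. -/
noncomputable def pSpaceLap (n : ℕ) (p : ℝ) (ψ : EuclideanSpace ℝ (Fin n) × ℝ → ℝ)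
    (q : EuclideanSpace ℝ (Fin n) × ℝ) : ℝ :=
  pLap n p (fun x => ψ (x, q.2)) q.1

/-- The time derivative `ψ_t` of a parabolic test function. -/
noncomputable def timeDeriv (n : ℕ) (ψ : EuclideanSpace ℝ (Fin n) × ℝ → ℝ)
    (q : EuclideanSpace ℝ (Fin n) × ℝ) : ℝ :=
  deriv (fun t => ψ (q.1, t)) q.2

/-- Viscosity subsolution of Trudinger's equation `Γ_p u = Δ_p u − (p−1)u^{p−2}u_t = 0` on `U`. -/
def TrudSub (n : ℕ) (p : ℝ) (U : Set (EuclideanSpace ℝ (Fin n) × ℝ))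
    (u : EuclideanSpace ℝ (Fin n) × ℝ → ℝ) : Prop :=
  ∀ ψ, ParaTestFn n ψ → ∀ q ∈ U, IsLocalMaxOn (fun z => u z - ψ z) U q →
    0 ≤ pSpaceLap n p ψ q - (p - 1) * u q ^ (p - 2) * timeDeriv n ψ q

/-- Viscosity supersolution of Trudinger's equation `Γ_p u = 0` on `U`. -/
def TrudSuper (n : ℕ) (p : ℝ) (U : Set (EuclideanSpace ℝ (Fin n) × ℝ))
    (u : EuclideanSpace ℝ (Fin n) × ℝ → ℝ) : Prop :=
  ∀ ψ, ParaTestFn n ψ → ∀ q ∈ U, IsLocalMinOn (fun z => u z - ψ z) U q →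
    pSpaceLap n p ψ q - (p - 1) * u q ^ (p - 2) * timeDeriv n ψ q ≤ 0

/-- Viscosity subsolution of `Δ_p u − (p−1)|u|^{p−2}u_t = 0` on `U`. -/
def TrudAbsSub (n : ℕ) (p : ℝ) (U : Set (EuclideanSpace ℝ (Fin n) × ℝ))
    (u : EuclideanSpace ℝ (Fin n) × ℝ → ℝ) : Prop :=
  ∀ ψ, ParaTestFn n ψ → ∀ q ∈ U, IsLocalMaxOn (fun z => u z - ψ z) U q →
    0 ≤ pSpaceLap n p ψ q - (p - 1) * |u q| ^ (p - 2) * timeDeriv n ψ q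

/-- Viscosity subsolution of `G_p w = Δ_p w + (p−1)|Dw|^p − (p−1)w_t = 0` on `U`. -/
def GpSub (n : ℕ) (p : ℝ) (U : Set (EuclideanSpace ℝ (Fin n) × ℝ))
    (w : EuclideanSpace ℝ (Fin n) × ℝ → ℝ) : Prop :=
  ∀ ψ, ParaTestFn n ψ → ∀ q ∈ U, IsLocalMaxOn (fun z => w z - ψ z) U q →
    0 ≤ pSpaceLap n p ψ q + (p - 1) * ‖gradient (fun x => ψ (x, q.2)) q.1‖ ^ p -
        (p - 1) * timeDeriv n ψ q

/-- Viscosity supersolution of `G_p w = 0` on `U`. -/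
def GpSuper (n : ℕ) (p : ℝ) (U : Set (EuclideanSpace ℝ (Fin n) × ℝ))
    (w : EuclideanSpace ℝ (Fin n) × ℝ → ℝ) : Prop :=
  ∀ ψ, ParaTestFn n ψ → ∀ q ∈ U, IsLocalMinOn (fun z => w z - ψ z) U q →
    pSpaceLap n p ψ q + (p - 1) * ‖gradient (fun x => ψ (x, q.2)) q.1‖ ^ p -
        (p - 1) * timeDeriv n ψ q ≤ 0

/-- Viscosity subsolution of `Γ_∞ u = Δ_∞ u − 3u²u_t = 0` on `U`. -/
def GammaInfSub (n : ℕ) (U : Set (EuclideanSpace ℝ (Fin n) × ℝ))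
    (u : EuclideanSpace ℝ (Fin n) × ℝ → ℝ) : Prop :=
  ∀ ψ, ParaTestFn n ψ → ∀ q ∈ U, IsLocalMaxOn (fun z => u z - ψ z) U q →
    0 ≤ infLap n (fun x => ψ (x, q.2)) q.1 - 3 * u q ^ 2 * timeDeriv n ψ q

/-- Viscosity supersolution of `Γ_∞ u = 0` on `U`. -/
def GammaInfSuper (n : ℕ) (U : Set (EuclideanSpace ℝ (Fin n) × ℝ))
    (u : EuclideanSpace ℝ (Fin n) × ℝ → ℝ) : Prop :=
  ∀ ψ, ParaTestFn n ψ → ∀ q ∈ U, IsLocalMinOn (fun z => u z - ψ z) U q →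
    infLap n (fun x => ψ (x, q.2)) q.1 - 3 * u q ^ 2 * timeDeriv n ψ q ≤ 0

/-- Viscosity subsolution of the elliptic equation `Δ_p u + f(x, u) = 0` on `Ω`. -/
def PLapFSub (n : ℕ) (p : ℝ) (f : EuclideanSpace ℝ (Fin n) → ℝ → ℝ)
    (Ω : Set (EuclideanSpace ℝ (Fin n))) (u : EuclideanSpace ℝ (Fin n) → ℝ) : Prop :=
  ∀ φ, ContDiff ℝ 2 φ → ∀ y ∈ Ω, IsLocalMaxOn (fun x => u x - φ x) Ω y →
    0 ≤ pLap n p φ y + f y (u y)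

/-- Viscosity supersolution of the elliptic equation `Δ_p u + f(x, u) = 0` on `Ω`. -/
def PLapFSuper (n : ℕ) (p : ℝ) (f : EuclideanSpace ℝ (Fin n) → ℝ → ℝ)
    (Ω : Set (EuclideanSpace ℝ (Fin n))) (u : EuclideanSpace ℝ (Fin n) → ℝ) : Prop :=
  ∀ φ, ContDiff ℝ 2 φ → ∀ y ∈ Ω, IsLocalMinOn (fun x => u x - φ x) Ω y →
    pLap n p φ y + f y (u y) ≤ 0

/-- The parabolic cylinder `Ω × I`. -/
def pcyl (n : ℕ) (Ω : Set (EuclideanSpace ℝ (Fin n))) (I : Set ℝ) :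
    Set (EuclideanSpace ℝ (Fin n) × ℝ) := Ω ×ˢ I

/-- The parabolic boundary `(cl(Ω) × {0}) ∪ (∂Ω × I)`. -/
def pbdry (n : ℕ) (Ω : Set (EuclideanSpace ℝ (Fin n))) (I : Set ℝ) :
    Set (EuclideanSpace ℝ (Fin n) × ℝ) := closure Ω ×ˢ {(0 : ℝ)} ∪ frontier Ω ×ˢ I

/-- The set of `λ ≥ 0` such that `Δ_p w + λ w^{p−1} = 0` in `Ω`, `w = δ` on `∂Ω`, has a positive
viscosity solution `w ∈ C(cl Ω)`; its supremum is the first eigenvalue `λ_Ω`. -/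
def pEigenSet (n : ℕ) (p δ : ℝ) (Ω : Set (EuclideanSpace ℝ (Fin n))) : Set ℝ :=
  {lam : ℝ | 0 ≤ lam ∧ ∃ w : EuclideanSpace ℝ (Fin n) → ℝ,
    ContinuousOn w (closure Ω) ∧ (∀ x ∈ closure Ω, 0 < w x) ∧
    PLapFSub n p (fun _ s => lam * s ^ (p - 1)) Ω w ∧
    PLapFSuper n p (fun _ s => lam * s ^ (p - 1)) Ω w ∧
    ∀ x ∈ frontier Ω, w x = δ}

/-- A positive viscosity solution of the boundary value problem `Γ_p u = 0` in `Ω × I`,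
`u = h` on the parabolic boundary. -/
def TrudBVPSol (n : ℕ) (p : ℝ) (Ω : Set (EuclideanSpace ℝ (Fin n))) (I : Set ℝ)
    (h u : EuclideanSpace ℝ (Fin n) × ℝ → ℝ) : Prop :=
  ContinuousOn u (pcyl n Ω I ∪ pbdry n Ω I) ∧
  (∀ q ∈ pcyl n Ω I ∪ pbdry n Ω I, 0 < u q) ∧
  TrudSub n p (pcyl n Ω I) u ∧ TrudSuper n p (pcyl n Ω I) u ∧
  ∀ q ∈ pbdry n Ω I, u q = h q

/-- The concave paraboloid `s (R² - |x - x₀|²) + c`. -/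
noncomputable def paraboloid (n : ℕ) (x₀ : EuclideanSpace ℝ (Fin n)) (s R c : ℝ)
    (x : EuclideanSpace ℝ (Fin n)) : ℝ :=
  s * (R ^ 2 - ‖x - x₀‖ ^ 2) + c

lemma contDiff_paraboloid (n : ℕ) (x₀ : EuclideanSpace ℝ (Fin n)) (s R c : ℝ) :
    ContDiff ℝ 2 (paraboloid n x₀ s R c) := by
  unfold paraboloid
  exact (contDiff_const.mul (contDiff_const.sub
    ((contDiff_id.sub contDiff_const).norm_sq ℝ))).add contDiff_const

lemma hasFDerivAt_paraboloid (n : ℕ) (x₀ : EuclideanSpace ℝ (Fin n)) (s R c : ℝ)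
    (x : EuclideanSpace ℝ (Fin n)) :
    HasFDerivAt (paraboloid n x₀ s R c) ((-(2 * s)) • innerSL ℝ (x - x₀)) x := by
  have h := ((((hasFDerivAt_id x).sub_const x₀).norm_sq.const_sub (R ^ 2)).const_mul s).add_const c
  refine h.congr_fderiv ?_
  ext y
  simp
  ring

lemma gradient_paraboloid (n : ℕ) (x₀ : EuclideanSpace ℝ (Fin n)) (s R c : ℝ)
    (x : EuclideanSpace ℝ (Fin n)) :
    gradient (paraboloid n x₀ s R c) x = (-(2 * s)) • (x - x₀) := by
  apply HasGradientAt.gradient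
  rw [hasGradientAt_iff_hasFDerivAt]
  refine (hasFDerivAt_paraboloid n x₀ s R c x).congr_fderiv ?_
  ext y
  simp

lemma iteratedFDeriv_two_paraboloid (n : ℕ) (x₀ : EuclideanSpace ℝ (Fin n)) (s R c : ℝ)
    (x a b : EuclideanSpace ℝ (Fin n)) :
    iteratedFDeriv ℝ 2 (paraboloid n x₀ s R c) x ![a, b] = -(2 * s) * inner ℝ a b := by
  have h1 : fderiv ℝ (paraboloid n x₀ s R c) = fun x => (-(2 * s)) • innerSL ℝ (x - x₀) :=
    funext fun y => (hasFDerivAt_paraboloid n x₀ s R c y).fderiv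
  have h2 : HasFDerivAt (fun x => (-(2 * s)) • innerSL ℝ (x - x₀))
      ((-(2 * s)) • (innerSL ℝ : EuclideanSpace ℝ (Fin n) →L[ℝ] _)) x :=
    (((innerSL ℝ : EuclideanSpace ℝ (Fin n) →L[ℝ] _).hasFDerivAt
      (x := x - x₀)).comp x ((hasFDerivAt_id x).sub_const x₀)).const_smul (-(2 * s))
  rw [iteratedFDeriv_two_apply, h1, h2.fderiv]
  change -(2 * s) • innerSL ℝ a b = _
  rw [innerSL_apply_apply, smul_eq_mul]

lemma pLap_paraboloid_le (n : ℕ) (hn : 0 < n) {p : ℝ} (hp : 2 ≤ p)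
    (x₀ : EuclideanSpace ℝ (Fin n)) {s : ℝ} (hs : 0 < s) (R c : ℝ)
    {x : EuclideanSpace ℝ (Fin n)} (hx : 1 ≤ ‖x - x₀‖) :
    pLap n p (paraboloid n x₀ s R c) x ≤ -(2 * s * n * (2 * s) ^ (p - 2)) := by
  have hg := gradient_paraboloid n x₀ s R c x
  have hnorm : 2 * s ≤ ‖gradient (paraboloid n x₀ s R c) x‖ := by
    rw [hg, norm_smul, norm_neg, Real.norm_of_nonneg (by positivity)]
    nlinarith
  have hne : gradient (paraboloid n x₀ s R c) x ≠ 0 := by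
    rw [← norm_pos_iff]; linarith
  unfold pLap
  rw [if_neg hne]
  simp only [iteratedFDeriv_two_paraboloid, real_inner_self_eq_norm_sq]
  set G := ‖gradient (paraboloid n x₀ s R c) x‖
  have hsum : ∑ i : Fin n, -(2 * s) * ‖EuclideanSpace.single i (1 : ℝ)‖ ^ 2 = -(2 * s * n) := by
    simp; ring
  rw [hsum]
  have h1 : (2 * s) ^ (p - 2) ≤ G ^ (p - 2) :=
    Real.rpow_le_rpow (by positivity) hnorm (by linarith)
  have h2 : 0 ≤ (p - 2) * G ^ (p - 4) * (2 * s * G ^ 2) :=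
    mul_nonneg (mul_nonneg (by linarith) (Real.rpow_nonneg (norm_nonneg _) _)) (by positivity)
  have h3 := mul_le_mul_of_nonneg_left h1 (show 0 ≤ 2 * s * n by positivity)
  linarith

lemma pcyl_union_pbdry (n : ℕ) (Ω : Set (EuclideanSpace ℝ (Fin n))) (hΩo : IsOpen Ω) :
    pcyl n Ω (Ioi 0) ∪ pbdry n Ω (Ioi 0) = closure Ω ×ˢ Ici (0 : ℝ) := by
  ext ⟨x, t⟩
  simp only [pcyl, pbdry, mem_union, mem_prod, mem_Ioi, mem_singleton_iff, mem_Ici,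
    hΩo.frontier_eq, Set.mem_sdiff]
  constructor
  · rintro (⟨h1, h2⟩ | ⟨h1, rfl⟩ | ⟨h1, h2⟩)
    · exact ⟨subset_closure h1, h2.le⟩
    · exact ⟨h1, le_rfl⟩
    · exact ⟨h1.1, h2.le⟩
  · rintro ⟨h1, h2⟩
    rcases h2.eq_or_lt with h | h
    · exact Or.inr (Or.inl ⟨h1, h.symm⟩)
    · by_cases hx : x ∈ Ω
      · exact Or.inl ⟨hx, h⟩
      · exact Or.inr (Or.inr ⟨⟨h1, hx⟩, h⟩)

/-- Comparison of a subsolution with a barrier `s (R² - |x - x₀|²) + η(t)`, where `η` does not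
decrease too fast. -/
lemma le_barrier_of_trudSub (n : ℕ) (hn : 0 < n) {p : ℝ} (hp : 2 ≤ p)
    {Ω : Set (EuclideanSpace ℝ (Fin n))} (hΩo : IsOpen Ω) (hΩb : Bornology.IsBounded Ω)
    {u : EuclideanSpace ℝ (Fin n) × ℝ → ℝ}
    (husc : UpperSemicontinuousOn u (closure Ω ×ˢ Ici (0 : ℝ)))
    (hu0 : ∀ q ∈ closure Ω ×ˢ Ici (0 : ℝ), 0 ≤ u q)
    (hsub : TrudSub n p (pcyl n Ω (Ioi 0)) u)
    {x₀ : EuclideanSpace ℝ (Fin n)} {R s T₀ : ℝ} (hs : 0 < s) (hT₀ : 0 ≤ T₀)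
    (hx₀ : ∀ x ∈ Ω, 1 ≤ ‖x - x₀‖) (hR : ∀ x ∈ closure Ω, ‖x - x₀‖ ≤ R)
    {η : ℝ → ℝ} (hη : ContDiff ℝ 1 η)
    (hslope : ∀ x ∈ Ω, ∀ t, T₀ < t →
      -(2 * s * n * (2 * s) ^ (p - 2)) < (p - 1) * u (x, t) ^ (p - 2) * deriv η t)
    (hbase : ∀ x ∈ closure Ω, u (x, T₀) ≤ η T₀)
    (hlat : ∀ x ∈ frontier Ω, ∀ t, T₀ < t → u (x, t) ≤ η t) :
    ∀ x ∈ closure Ω, ∀ t, T₀ ≤ t → u (x, t) ≤ s * (R ^ 2 - ‖x - x₀‖ ^ 2) + η t := by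
  intro x₁ hx₁ t₁ ht₁
  by_contra! hlt
  set v : EuclideanSpace ℝ (Fin n) → ℝ := fun x => s * (R ^ 2 - ‖x - x₀‖ ^ 2) with hv
  have hv0 : ∀ x ∈ closure Ω, 0 ≤ v x := fun x hx =>
    mul_nonneg hs.le (sub_nonneg.2 (pow_le_pow_left₀ (norm_nonneg _) (hR x hx) 2))
  have hvc : Continuous v := by fun_prop
  set K : Set (EuclideanSpace ℝ (Fin n) × ℝ) := closure Ω ×ˢ Icc T₀ (t₁ + 1) with hK
  have hKc : IsCompact K := hΩb.isCompact_closure.prod isCompact_Icc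
  have hKsub : K ⊆ closure Ω ×ˢ Ici (0 : ℝ) := fun q hq => ⟨hq.1, hT₀.trans hq.2.1⟩
  have hq₁ : (x₁, t₁) ∈ K := ⟨hx₁, ht₁, by simp⟩
  have usc_sub : ∀ ψ : EuclideanSpace ℝ (Fin n) × ℝ → ℝ, Continuous ψ →
      UpperSemicontinuousOn (fun q => u q - ψ q) K := by
    intro ψ hψ
    simp only [sub_eq_add_neg]
    exact (husc.mono hKsub).add hψ.neg.continuousOn.upperSemicontinuousOn
  obtain ⟨qB, -, hqB⟩ := (usc_sub (fun q => v q.1 + η q.2)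
    ((hvc.comp continuous_fst).add (hη.continuous.comp continuous_snd))).exists_isMaxOn
    ⟨_, hq₁⟩ hKc
  set B := u qB - (v qB.1 + η qB.2)
  have hB : ∀ q ∈ K, u q - (v q.1 + η q.2) ≤ B := fun q hq => hqB hq
  set μ := (u (x₁, t₁) - (v x₁ + η t₁)) / 2 with hμ
  have hμ0 : 0 < μ := by
    rw [hμ]; simp only [hv]; linarith
  have hBμ : 2 * μ ≤ B := by
    have := hB _ hq₁
    rw [hμ]; simp only at this; linarith
  set k := B / μ with hk
  have hk0 : 0 ≤ k := div_nonneg (by linarith) hμ0.le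
  set θ : ℝ → ℝ := fun t => η t + μ * Real.exp (k * (t - t₁)) with hθ
  have hθd : ContDiff ℝ 1 θ := by
    rw [hθ]; fun_prop
  set ψ : EuclideanSpace ℝ (Fin n) × ℝ → ℝ := fun q => paraboloid n x₀ s R (θ q.2) q.1 with hψ
  have hψv : ∀ q, ψ q = v q.1 + θ q.2 := fun q => rfl
  obtain ⟨q, hqK, hqmax⟩ := (usc_sub ψ ((hvc.comp continuous_fst).add
    (hθd.continuous.comp continuous_snd))).exists_isMaxOn ⟨_, hq₁⟩ hKc
  have hqpos : μ ≤ u q - ψ q := by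
    have h1 : u (x₁, t₁) - ψ (x₁, t₁) ≤ u q - ψ q := hqmax hq₁
    rw [hψv (x₁, t₁)] at h1
    simp only [hθ, sub_self, mul_zero, Real.exp_zero, mul_one] at h1
    linarith
  obtain ⟨y, τ⟩ := q
  rw [hψv] at hqpos
  simp only [hθ] at hqpos
  have hexp : 0 < μ * Real.exp (k * (τ - t₁)) := by positivity
  have hvy := hv0 y hqK.1
  have hτ0 : T₀ < τ := by
    refine lt_of_le_of_ne hqK.2.1 ?_
    rintro rfl
    have := hbase y hqK.1
    linarith
  have hyΩ : y ∈ Ω := by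
    by_contra hy
    have := hlat y (by rw [hΩo.frontier_eq]; exact ⟨hqK.1, hy⟩) τ hτ0
    linarith
  have hτ1 : τ < t₁ + 1 := by
    refine lt_of_le_of_ne hqK.2.2 ?_
    rintro rfl
    have h1 := hB _ hqK
    have h2 : B ≤ μ * Real.exp (k * (t₁ + 1 - t₁)) := by
      rw [add_sub_cancel_left, mul_one]
      have h3 := Real.add_one_le_exp k
      have h4 : μ * k = B := by rw [hk]; field_simp
      nlinarith
    simp only at h1
    linarith
  have hloc : IsLocalMaxOn (fun z => u z - ψ z) (pcyl n Ω (Ioi 0)) (y, τ) := by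
    have hnhds : Ω ×ˢ Ioo T₀ (t₁ + 1) ∈ nhds (y, τ) :=
      (hΩo.prod isOpen_Ioo).mem_nhds ⟨hyΩ, hτ0, hτ1⟩
    filter_upwards [mem_nhdsWithin_of_mem_nhds hnhds] with z hz
    exact hqmax ⟨subset_closure hz.1, hz.2.1.le, hz.2.2.le⟩
  have hpara : ParaTestFn n ψ :=
    ⟨fun t => contDiff_paraboloid n x₀ s R (θ t), fun x => (contDiff_const (c := v x)).add hθd⟩
  have hτpos : 0 < τ := hT₀.trans_lt hτ0
  have hvisc := hsub ψ hpara (y, τ) ⟨hyΩ, hτpos⟩ hloc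
  have hlap : pSpaceLap n p ψ (y, τ) ≤ -(2 * s * n * (2 * s) ^ (p - 2)) :=
    pLap_paraboloid_le n hn hp x₀ hs R (θ τ) (hx₀ y hyΩ)
  have htime : deriv η τ ≤ timeDeriv n ψ (y, τ) := by
    have hd : HasDerivAt (fun t => ψ (y, t))
        (deriv η τ + μ * (Real.exp (k * (τ - t₁)) * (k * 1))) τ :=
      (((hη.differentiable one_ne_zero τ).hasDerivAt).add
        (((((hasDerivAt_id τ).sub_const t₁).const_mul k).exp).const_mul μ)).const_add (v y)
    rw [timeDeriv, hd.deriv]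
    have : 0 ≤ μ * (Real.exp (k * (τ - t₁)) * (k * 1)) := by positivity
    linarith
  have hcoef : 0 ≤ (p - 1) * u (y, τ) ^ (p - 2) :=
    mul_nonneg (by linarith) (Real.rpow_nonneg (hu0 _ ⟨hqK.1, hτpos.le⟩) _)
  have := mul_le_mul_of_nonneg_left htime hcoef
  have := hslope y hyΩ τ hτ0
  linarith

/-- Theorem 1.6(i): decay of nonnegative subsolutions of Trudinger's equation when the
lateral boundary data tends to `0`. -/
theorem stmt0 (n : ℕ) (hn : 2 ≤ n) (p : ℝ) (hp : 2 ≤ p)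
    (Ω : Set (EuclideanSpace ℝ (Fin n))) (hΩo : IsOpen Ω) (hΩc : IsConnected Ω)
    (hΩb : Bornology.IsBounded Ω)
    (f : EuclideanSpace ℝ (Fin n) → ℝ) (g : EuclideanSpace ℝ (Fin n) → ℝ → ℝ)
    (h u : EuclideanSpace ℝ (Fin n) × ℝ → ℝ)
    (hh : ContinuousOn h (pbdry n Ω (Set.Ioi 0)))
    (hhf : ∀ x ∈ closure Ω, h (x, 0) = f x)
    (hhg : ∀ x ∈ frontier Ω, ∀ t : ℝ, 0 < t → h (x, t) = g x t)
    (hh0 : ∀ q ∈ pbdry n Ω (Set.Ioi 0), 0 ≤ h q)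
    (hhb : BddAbove (h '' pbdry n Ω (Set.Ioi 0)))
    (husc : UpperSemicontinuousOn u (pcyl n Ω (Set.Ioi 0) ∪ pbdry n Ω (Set.Ioi 0)))
    (hu0 : ∀ q ∈ pcyl n Ω (Set.Ioi 0) ∪ pbdry n Ω (Set.Ioi 0), 0 ≤ u q)
    (hsub : TrudSub n p (pcyl n Ω (Set.Ioi 0)) u)
    (huh : ∀ q ∈ pbdry n Ω (Set.Ioi 0), u q ≤ h q)
    (hg : Filter.Tendsto (fun t => sSup ((fun x => g x t) '' frontier Ω))
      Filter.atTop (nhds 0)) :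
    Filter.Tendsto (fun t => sSup (u '' (Ω ×ˢ Set.Ici t))) Filter.atTop (nhds 0) := by
  rw [pcyl_union_pbdry n Ω hΩo] at husc hu0
  have hn0 : 0 < n := by omega
  have hnR : (0 : ℝ) < n := by exact_mod_cast hn0
  obtain ⟨x₀, R, hx₀, hR⟩ : ∃ (x₀ : EuclideanSpace ℝ (Fin n)) (R : ℝ),
      (∀ x ∈ Ω, 1 ≤ ‖x - x₀‖) ∧ ∀ x ∈ closure Ω, ‖x - x₀‖ ≤ R := by
    obtain ⟨r, hr⟩ := hΩb.closure.exists_norm_le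
    set x₀ : EuclideanSpace ℝ (Fin n) := EuclideanSpace.single ⟨0, hn0⟩ (|r| + 1) with hx₀
    have hnorm : ‖x₀‖ = |r| + 1 := by
      rw [hx₀, PiLp.norm_single, Real.norm_of_nonneg (by positivity)]
    refine ⟨x₀, r + ‖x₀‖, fun x hx => ?_, fun x hx => ?_⟩
    · have h1 := hr x (subset_closure hx)
      have h2 := norm_sub_norm_le x₀ x
      rw [norm_sub_rev] at h2
      have := le_abs_self r
      linarith
    · exact (norm_sub_le x x₀).trans (by have := hr x hx; linarith)
  obtain ⟨B, hB⟩ := hhb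
  have hhB : ∀ q ∈ pbdry n Ω (Ioi 0), h q ≤ B := fun q hq => hB ⟨q, hq, rfl⟩
  set M := R ^ 2 + |B| + 1 with hM
  have hM0 : 0 < M := by positivity
  have huM : ∀ x ∈ closure Ω, ∀ t, 0 ≤ t → u (x, t) ≤ M := by
    intro x hx t ht
    have h1 := le_barrier_of_trudSub n hn0 hp hΩo hΩb husc hu0 hsub one_pos le_rfl hx₀ hR
      (η := fun _ => B) contDiff_const
      (fun x _ t _ => by
        rw [deriv_const, mul_zero, neg_lt_zero]
        positivity)
      (fun x hx => (huh (x, 0) (Or.inl ⟨hx, rfl⟩)).trans (hhB _ (Or.inl ⟨hx, rfl⟩)))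
      (fun x hx t ht => (huh (x, t) (Or.inr ⟨hx, ht⟩)).trans (hhB _ (Or.inr ⟨hx, ht⟩))) x hx t ht
    have h2 := le_abs_self B
    nlinarith [sq_nonneg ‖x - x₀‖]
  have decay : ∀ ε > 0, ∀ᶠ t in atTop, ∀ x ∈ Ω, u (x, t) ≤ 3 * ε := by
    intro ε hε
    obtain ⟨T₀, hT₀⟩ := eventually_atTop.1
      ((hg.eventually_lt_const hε).and (eventually_gt_atTop (0 : ℝ)))
    have hT₀pos : 0 < T₀ := (hT₀ T₀ le_rfl).2
    set s := ε / (R ^ 2 + 1) with hs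
    have hs0 : 0 < s := by positivity
    have hsR : s * R ^ 2 ≤ ε := by
      rw [hs, div_mul_eq_mul_div, div_le_iff₀ (by positivity)]
      nlinarith
    set c := 2 * s * n * (2 * s) ^ (p - 2) with hc
    have hc0 : 0 < c := by positivity
    set A := (p - 1) * M ^ (p - 2) * M with hA
    have hp1 : 0 < p - 1 := by linarith
    have hA0 : 0 < A := by positivity
    set δ := c / (2 * A) with hδ
    have hδ0 : 0 < δ := by positivity
    have hAδ : A * δ < c := by
      have : A * δ = c / 2 := by rw [hδ]; field_simp
      linarith
    set η : ℝ → ℝ := fun t => ε + M * Real.exp (-δ * (t - T₀)) with hη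
    have hderiv : ∀ t, deriv η t = M * (Real.exp (-δ * (t - T₀)) * (-δ * 1)) := fun t =>
      ((((((hasDerivAt_id t).sub_const T₀).const_mul (-δ)).exp).const_mul M).const_add ε).deriv
    have hbound := le_barrier_of_trudSub n hn0 hp hΩo hΩb husc hu0 hsub hs0 hT₀pos.le hx₀ hR
      (η := η) (by rw [hη]; fun_prop)
      (fun x hx t ht => by
        rw [hderiv]
        have hx' := subset_closure hx
        have ht0 : 0 ≤ t := hT₀pos.le.trans ht.le
        have h1 : u (x, t) ^ (p - 2) ≤ M ^ (p - 2) :=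
          Real.rpow_le_rpow (hu0 _ ⟨hx', ht0⟩) (huM x hx' t ht0) (by linarith)
        have h2 : Real.exp (-δ * (t - T₀)) ≤ 1 := Real.exp_le_one_iff.2 (by nlinarith)
        have h3 : (p - 1) * u (x, t) ^ (p - 2) * (M * (Real.exp (-δ * (t - T₀)) * δ)) ≤
            (p - 1) * M ^ (p - 2) * (M * (1 * δ)) := by gcongr
        have h4 : (p - 1) * M ^ (p - 2) * (M * (1 * δ)) = A * δ := by rw [hA]; ring
        linarith)
      (fun x hx => by
        have := huM x hx T₀ hT₀pos.le
        simp only [hη, sub_self, mul_zero, Real.exp_zero]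
        linarith)
      (fun x hx t ht => by
        have ht0 : 0 < t := hT₀pos.trans ht
        have hbdd : BddAbove ((fun x => g x t) '' frontier Ω) := by
          refine ⟨B, ?_⟩
          rintro _ ⟨z, hz, rfl⟩
          simpa only [hhg z hz t ht0] using hhB (z, t) (Or.inr ⟨hz, ht0⟩)
        have h1 : u (x, t) ≤ g x t := hhg x hx t ht0 ▸ huh (x, t) (Or.inr ⟨hx, ht0⟩)
        have h2 : g x t ≤ sSup ((fun x => g x t) '' frontier Ω) := le_csSup hbdd ⟨x, hx, rfl⟩
        have h3 := (hT₀ t ht.le).1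
        have h4 : 0 < M * Real.exp (-δ * (t - T₀)) := by positivity
        simp only [hη]
        linarith)
    have hlim : Tendsto (fun t => M * Real.exp (-δ * (t - T₀))) atTop (nhds 0) := by
      have h1 : Tendsto (fun t => -δ * (t - T₀)) atTop atBot :=
        (tendsto_atTop_add_const_right _ (-T₀) tendsto_id).const_mul_atTop_of_neg
          (neg_lt_zero.2 hδ0)
      simpa using (Real.tendsto_exp_atBot.comp h1).const_mul M
    filter_upwards [hlim.eventually_lt_const hε, eventually_ge_atTop T₀] with t ht htT x hx
    have h1 := hbound x (subset_closure hx) t htT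
    simp only [hη] at h1
    nlinarith [sq_nonneg ‖x - x₀‖]
  rw [Metric.tendsto_atTop]
  intro ε hε
  obtain ⟨T, hT⟩ := eventually_atTop.1
    ((decay (ε / 4) (by positivity)).and (eventually_ge_atTop (0 : ℝ)))
  refine ⟨T, fun t ht => ?_⟩
  obtain ⟨x, hx⟩ := hΩc.nonempty
  have hle : sSup (u '' (Ω ×ˢ Ici t)) ≤ 3 * (ε / 4) := by
    refine csSup_le ⟨_, (x, t), ⟨hx, self_mem_Ici⟩, rfl⟩ ?_
    rintro _ ⟨⟨y, r⟩, ⟨hy, hr⟩, rfl⟩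
    exact (hT r (ht.trans hr)).1 y hy
  have hge : 0 ≤ sSup (u '' (Ω ×ˢ Ici t)) := by
    refine Real.sSup_nonneg ?_
    rintro _ ⟨⟨y, r⟩, ⟨hy, hr⟩, rfl⟩
    exact hu0 _ ⟨subset_closure hy, (hT r (ht.trans hr)).2⟩
  rw [Real.dist_eq, sub_zero, abs_of_nonneg hge]
  linarith
end

section
/- Let 2 ≤ p < ∞ and let Ω ⊂ ℝⁿ (n ≥ 2) be a bounded domain. Let f ∈ C(cl Ω) with 0 < inf_Ω f ≤ 1 ≤ sup_Ω f < ∞. Suppose u ∈ C(Ω_∞ ∪ P_∞), u > 0, is a viscosity solution of Γ_p u = 0 in Ω_∞ with u(x,0) = f(x) for all x ∈ cl(Ω) and u(x,t) = 1 for all (x,t) ∈ ∂Ω×[0,∞). Then for every x ∈ Ω, lim_{t→∞} u(x,t) = 1. -/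
open Set Filter
open scoped Classical

/-- The function `(x, t) ↦ a(t) + b(t) |x - x₀|²`, the shape of all the barriers used below. -/
noncomputable def quadBarrier (n : ℕ) (x₀ : EuclideanSpace ℝ (Fin n)) (a b : ℝ → ℝ) :
    EuclideanSpace ℝ (Fin n) × ℝ → ℝ :=
  fun z => a z.2 + b z.2 * ‖z.1 - x₀‖ ^ 2

section Quadratic

variable {n : ℕ}

lemma hasFDerivAt_quad (x₀ : EuclideanSpace ℝ (Fin n)) (a b : ℝ) (x : EuclideanSpace ℝ (Fin n)) :
    HasFDerivAt (fun y => a + b * ‖y - x₀‖ ^ 2) ((2 * b) • innerSL ℝ (x - x₀)) x := by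
  have h := (((hasFDerivAt_id x).sub_const x₀).norm_sq.const_mul b).const_add a
  refine h.congr_fderiv ?_
  ext v
  simp
  ring

lemma gradient_quad (x₀ : EuclideanSpace ℝ (Fin n)) (a b : ℝ) (x : EuclideanSpace ℝ (Fin n)) :
    gradient (fun y => a + b * ‖y - x₀‖ ^ 2) x = (2 * b) • (x - x₀) := by
  refine HasGradientAt.gradient ?_
  rw [hasGradientAt_iff_hasFDerivAt]
  refine (hasFDerivAt_quad x₀ a b x).congr_fderiv ?_
  ext v
  simp

lemma iteratedFDeriv_two_quad (x₀ : EuclideanSpace ℝ (Fin n)) (a b : ℝ)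
    (x v w : EuclideanSpace ℝ (Fin n)) :
    iteratedFDeriv ℝ 2 (fun y => a + b * ‖y - x₀‖ ^ 2) x ![v, w] = 2 * b * inner ℝ v w := by
  rw [iteratedFDeriv_two_apply]
  have h1 : fderiv ℝ (fun y => a + b * ‖y - x₀‖ ^ 2) =
      fun y => (2 * b) • innerSL ℝ (y - x₀) := by
    ext1 y
    exact (hasFDerivAt_quad x₀ a b y).fderiv
  have h2 : HasFDerivAt (fun y => (2 * b) • innerSL ℝ (y - x₀)) ((2 * b) • innerSL ℝ) x :=
    ((innerSL ℝ).hasFDerivAt.comp x ((hasFDerivAt_id x).sub_const x₀)).const_smul (2 * b)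
  rw [h1, h2.fderiv]
  rfl

lemma pLap_quad (p : ℝ) (x₀ : EuclideanSpace ℝ (Fin n)) (a b : ℝ)
    (x : EuclideanSpace ℝ (Fin n)) (hb : b ≠ 0) (hx : x ≠ x₀) :
    pLap n p (fun y => a + b * ‖y - x₀‖ ^ 2) x =
      2 * b * (n + p - 2) * (2 * |b| * ‖x - x₀‖) ^ (p - 2) := by
  have hg : (2 * b) • (x - x₀) ≠ 0 :=
    smul_ne_zero (mul_ne_zero two_ne_zero hb) (sub_ne_zero.mpr hx)
  have hnorm : ‖(2 * b) • (x - x₀)‖ = 2 * |b| * ‖x - x₀‖ := by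
    rw [norm_smul, Real.norm_eq_abs, abs_mul, abs_two]
  have hpos : 0 < 2 * |b| * ‖x - x₀‖ := hnorm ▸ norm_pos_iff.mpr hg
  have hpow : (2 * |b| * ‖x - x₀‖) ^ (p - 2) =
      (2 * |b| * ‖x - x₀‖) ^ (p - 4) * (2 * |b| * ‖x - x₀‖) ^ 2 := by
    rw [← Real.rpow_natCast, ← Real.rpow_add hpos]
    congr 1
    push_cast
    ring
  unfold pLap
  rw [gradient_quad, if_neg hg]
  simp only [iteratedFDeriv_two_quad, real_inner_self_eq_norm_sq, hnorm,
    PiLp.norm_single, norm_one, one_pow, Finset.sum_const, Finset.card_univ,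
    Fintype.card_fin, nsmul_eq_mul]
  rw [hpow]
  ring

lemma le_pLap_quad (hn : 2 ≤ n) {p : ℝ} (hp : 2 ≤ p) {x₀ x : EuclideanSpace ℝ (Fin n)}
    (a : ℝ) {b β : ℝ} (hβ : 0 < β) (hb : β ≤ b) (hx : 1 ≤ ‖x - x₀‖) :
    2 * β * (n + p - 2) * (2 * β) ^ (p - 2) ≤ pLap n p (fun y => a + b * ‖y - x₀‖ ^ 2) x := by
  have hb0 : 0 < b := hβ.trans_le hb
  have hne : x ≠ x₀ := by
    rintro rfl
    norm_num at hx
  have hn' : (2 : ℝ) ≤ n := by exact_mod_cast hn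
  rw [pLap_quad p x₀ a b x hb0.ne' hne, abs_of_pos hb0]
  have h1 : 2 * β ≤ 2 * b * ‖x - x₀‖ := by nlinarith
  have h2 : (2 * β) ^ (p - 2) ≤ (2 * b * ‖x - x₀‖) ^ (p - 2) :=
    Real.rpow_le_rpow (by positivity) h1 (by linarith)
  have h3 : 0 ≤ n + p - 2 := by linarith
  gcongr

lemma pLap_quad_le (hn : 2 ≤ n) {p : ℝ} (hp : 2 ≤ p) {x₀ x : EuclideanSpace ℝ (Fin n)}
    (a : ℝ) {b β : ℝ} (hβ : 0 < β) (hb : b ≤ -β) (hx : 1 ≤ ‖x - x₀‖) :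
    pLap n p (fun y => a + b * ‖y - x₀‖ ^ 2) x ≤
      -(2 * β * (n + p - 2) * (2 * β) ^ (p - 2)) := by
  have hne : x ≠ x₀ := by
    rintro rfl
    norm_num at hx
  have hb0 : b < 0 := by linarith
  have h := le_pLap_quad hn hp a hβ (le_neg_of_le_neg hb) hx
  rw [pLap_quad p x₀ a _ x (neg_ne_zero.mpr hb0.ne) hne, abs_neg] at h
  rw [pLap_quad p x₀ a b x hb0.ne hne]
  linarith

lemma paraTestFn_quadBarrier (x₀ : EuclideanSpace ℝ (Fin n)) {a b : ℝ → ℝ}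
    (ha : ContDiff ℝ 1 a) (hb : ContDiff ℝ 1 b) : ParaTestFn n (quadBarrier n x₀ a b) := by
  refine ⟨fun t => ?_, fun x => ?_⟩
  · have h : ContDiff ℝ 2 fun x => ‖x - x₀‖ ^ 2 := (contDiff_id.sub contDiff_const).norm_sq ℝ
    exact (contDiff_const (c := a t)).add ((contDiff_const (c := b t)).mul h)
  · exact ha.add (hb.mul (contDiff_const (c := ‖x - x₀‖ ^ 2)))

lemma continuous_quadBarrier (x₀ : EuclideanSpace ℝ (Fin n)) {a b : ℝ → ℝ}
    (ha : ContDiff ℝ 1 a) (hb : ContDiff ℝ 1 b) : Continuous (quadBarrier n x₀ a b) := by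
  have h1 := ha.continuous
  have h2 := hb.continuous
  unfold quadBarrier
  fun_prop

lemma timeDeriv_quadBarrier (x₀ : EuclideanSpace ℝ (Fin n)) {a b : ℝ → ℝ} {a' b' : ℝ}
    {q : EuclideanSpace ℝ (Fin n) × ℝ} (ha : HasDerivAt a a' q.2) (hb : HasDerivAt b b' q.2) :
    timeDeriv n (quadBarrier n x₀ a b) q = a' + b' * ‖q.1 - x₀‖ ^ 2 :=
  (ha.add (hb.mul_const (‖q.1 - x₀‖ ^ 2))).deriv

end Quadratic

section Comparison

variable {n : ℕ} {p : ℝ} {Ω : Set (EuclideanSpace ℝ (Fin n))}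
  {u : EuclideanSpace ℝ (Fin n) × ℝ → ℝ}

lemma closure_prod_Ici_subset (Ω : Set (EuclideanSpace ℝ (Fin n))) :
    closure Ω ×ˢ Ici (0 : ℝ) ⊆ pcyl n Ω (Ioi 0) ∪ pbdry n Ω (Ioi 0) := by
  rintro ⟨x, t⟩ ⟨hx, ht⟩
  rcases (mem_Ici.mp ht).eq_or_lt with h0 | h0
  · exact Or.inr (Or.inl ⟨hx, h0.symm⟩)
  · rw [closure_eq_self_union_frontier] at hx
    rcases hx with hx | hx
    · exact Or.inl ⟨hx, h0⟩
    · exact Or.inr (Or.inr ⟨hx, h0⟩)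

lemma mem_Ioo_cylinder {S : ℝ} {q : EuclideanSpace ℝ (Fin n) × ℝ}
    (hq : q ∈ closure Ω ×ˢ Icc 0 S) (h0 : q.2 ≠ 0) (hS : q.2 ≠ S) (hfr : q.1 ∉ frontier Ω) :
    q ∈ Ω ×ˢ Ioo 0 S := by
  obtain ⟨hx, ht0, htS⟩ := hq
  rw [closure_eq_self_union_frontier] at hx
  exact ⟨hx.resolve_right hfr, ht0.lt_of_ne' h0, htS.lt_of_ne hS⟩

lemma cylinder_mem_nhds {S : ℝ} {q : EuclideanSpace ℝ (Fin n) × ℝ} (hΩo : IsOpen Ω)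
    (hq : q ∈ Ω ×ˢ Ioo 0 S) : closure Ω ×ˢ Icc 0 S ∈ nhds q :=
  mem_of_superset ((hΩo.prod isOpen_Ioo).mem_nhds hq)
    (prod_mono subset_closure Ioo_subset_Icc_self)

/-- A subsolution lies below a strict test supersolution on `cl Ω × [0, S]` if it does so on the
bottom, the top and the lateral boundary. -/
lemma TrudSub.le_of_boundary (hsub : TrudSub n p (pcyl n Ω (Ioi 0)) u) (hΩo : IsOpen Ω)
    (hΩb : Bornology.IsBounded Ω) (hu : ContinuousOn u (closure Ω ×ˢ Ici 0)) {S : ℝ}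
    {ψ : EuclideanSpace ℝ (Fin n) × ℝ → ℝ} (hψ : ParaTestFn n ψ) (hψc : Continuous ψ)
    (hbot : ∀ x ∈ closure Ω, u (x, 0) ≤ ψ (x, 0)) (htop : ∀ x ∈ closure Ω, u (x, S) ≤ ψ (x, S))
    (hlat : ∀ x ∈ frontier Ω, ∀ t ∈ Icc 0 S, u (x, t) ≤ ψ (x, t))
    (hstrict : ∀ q ∈ Ω ×ˢ Ioo 0 S, ψ q < u q →
      pSpaceLap n p ψ q - (p - 1) * u q ^ (p - 2) * timeDeriv n ψ q < 0) :
    ∀ q ∈ closure Ω ×ˢ Icc 0 S, u q ≤ ψ q := by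
  intro q₀ hq₀
  by_contra! hlt
  have hc : ContinuousOn (fun z => u z - ψ z) (closure Ω ×ˢ Icc 0 S) :=
    (hu.mono (prod_mono_right Icc_subset_Ici_self)).sub hψc.continuousOn
  obtain ⟨q, hq, hmax⟩ :=
    (hΩb.isCompact_closure.prod isCompact_Icc).exists_isMaxOn ⟨q₀, hq₀⟩ hc
  have hqpos : ψ q < u q := by
    have : u q₀ - ψ q₀ ≤ u q - ψ q := hmax hq₀
    linarith
  have hq' : q ∈ Ω ×ˢ Ioo 0 S := by
    obtain ⟨x, t⟩ := q
    refine mem_Ioo_cylinder hq ?_ ?_ fun h => (hlat x h t hq.2).not_gt hqpos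
    · rintro rfl
      exact (hbot x hq.1).not_gt hqpos
    · rintro rfl
      exact (htop x hq.1).not_gt hqpos
  have hloc : IsLocalMax (fun z => u z - ψ z) q := hmax.isLocalMax (cylinder_mem_nhds hΩo hq')
  exact (hsub ψ hψ q ⟨hq'.1, hq'.2.1⟩ (hloc.on _)).not_gt (hstrict q hq' hqpos)

/-- A supersolution lies above a strict test subsolution on `cl Ω × [0, S]` if it does so on the
bottom, the top and the lateral boundary. -/
lemma TrudSuper.le_of_boundary (hsuper : TrudSuper n p (pcyl n Ω (Ioi 0)) u) (hΩo : IsOpen Ω)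
    (hΩb : Bornology.IsBounded Ω) (hu : ContinuousOn u (closure Ω ×ˢ Ici 0)) {S : ℝ}
    {ψ : EuclideanSpace ℝ (Fin n) × ℝ → ℝ} (hψ : ParaTestFn n ψ) (hψc : Continuous ψ)
    (hbot : ∀ x ∈ closure Ω, ψ (x, 0) ≤ u (x, 0)) (htop : ∀ x ∈ closure Ω, ψ (x, S) ≤ u (x, S))
    (hlat : ∀ x ∈ frontier Ω, ∀ t ∈ Icc 0 S, ψ (x, t) ≤ u (x, t))
    (hstrict : ∀ q ∈ Ω ×ˢ Ioo 0 S, u q < ψ q →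
      0 < pSpaceLap n p ψ q - (p - 1) * u q ^ (p - 2) * timeDeriv n ψ q) :
    ∀ q ∈ closure Ω ×ˢ Icc 0 S, ψ q ≤ u q := by
  intro q₀ hq₀
  by_contra! hlt
  have hc : ContinuousOn (fun z => u z - ψ z) (closure Ω ×ˢ Icc 0 S) :=
    (hu.mono (prod_mono_right Icc_subset_Ici_self)).sub hψc.continuousOn
  obtain ⟨q, hq, hmin⟩ :=
    (hΩb.isCompact_closure.prod isCompact_Icc).exists_isMinOn ⟨q₀, hq₀⟩ hc
  have hqneg : u q < ψ q := by
    have : u q - ψ q ≤ u q₀ - ψ q₀ := hmin hq₀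
    linarith
  have hq' : q ∈ Ω ×ˢ Ioo 0 S := by
    obtain ⟨x, t⟩ := q
    refine mem_Ioo_cylinder hq ?_ ?_ fun h => (hlat x h t hq.2).not_gt hqneg
    · rintro rfl
      exact (hbot x hq.1).not_gt hqneg
    · rintro rfl
      exact (htop x hq.1).not_gt hqneg
  have hloc : IsLocalMin (fun z => u z - ψ z) q := hmin.isLocalMin (cylinder_mem_nhds hΩo hq')
  exact (hsuper ψ hψ q ⟨hq'.1, hq'.2.1⟩ (hloc.on _)).not_gt (hstrict q hq' hqneg)

lemma exists_center (hn : 2 ≤ n) (hΩb : Bornology.IsBounded Ω) :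
    ∃ (x₀ : EuclideanSpace ℝ (Fin n)) (D : ℝ),
      ∀ x ∈ closure Ω, 1 ≤ ‖x - x₀‖ ∧ ‖x - x₀‖ ^ 2 ≤ D := by
  obtain ⟨R, hR⟩ := hΩb.closure.exists_norm_le
  have : Nonempty (Fin n) := ⟨⟨0, by omega⟩⟩
  obtain ⟨x₀, hx₀⟩ := exists_norm_eq (EuclideanSpace ℝ (Fin n)) (c := |R| + 1) (by positivity)
  refine ⟨x₀, (2 * |R| + 1) ^ 2, fun x hx => ?_⟩
  have h1 : ‖x‖ ≤ |R| := (hR x hx).trans (le_abs_self R)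
  have h2 := norm_sub_norm_le x₀ x
  rw [norm_sub_rev] at h2
  have h3 := norm_sub_le x x₀
  exact ⟨by linarith, pow_le_pow_left₀ (norm_nonneg _) (by linarith) 2⟩

/-- A subsolution that is at most `M` on the parabolic boundary is at most `M` everywhere. -/
lemma TrudSub.le_of_parabolic_boundary (hn : 2 ≤ n) (hp : 2 ≤ p)
    (hsub : TrudSub n p (pcyl n Ω (Ioi 0)) u) (hΩo : IsOpen Ω)
    (hΩb : Bornology.IsBounded Ω) (hu : ContinuousOn u (closure Ω ×ˢ Ici 0))
    (hupos : ∀ q ∈ closure Ω ×ˢ Ici (0 : ℝ), 0 < u q) {M : ℝ} (hM : 0 ≤ M)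
    (hbot : ∀ x ∈ closure Ω, u (x, 0) ≤ M)
    (hlat : ∀ x ∈ frontier Ω, ∀ t : ℝ, 0 ≤ t → u (x, t) ≤ M) :
    ∀ q ∈ closure Ω ×ˢ Ici (0 : ℝ), u q ≤ M := by
  rintro ⟨x, t⟩ ⟨hx, ht⟩
  simp only [mem_Ici] at hx ht
  obtain ⟨x₀, D, hD⟩ := exists_center hn hΩb
  obtain ⟨K, hK⟩ := (hΩb.isCompact_closure.prod isCompact_Icc).bddAbove_image
    (hu.mono (prod_mono_right (Icc_subset_Ici_self : Icc 0 (t + 1) ⊆ Ici 0)))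
  have hK' : ∀ q ∈ closure Ω ×ˢ Icc 0 (t + 1), u q ≤ K := fun q hq => hK (mem_image_of_mem u hq)
  have hK0 : 0 ≤ K :=
    (hupos (x, t) ⟨hx, ht⟩).le.trans (hK' _ ⟨hx, ht, by simp⟩)
  have hD0 : 0 ≤ D := (sq_nonneg _).trans (hD x hx).2
  have key : ∀ ε : ℝ, 0 < ε → u (x, t) ≤ M + ε * (D + K) := by
    intro ε hε
    have ha : ContDiff ℝ 1 fun s : ℝ => M + ε * D + K * Real.exp (ε⁻¹ * (s - (t + 1))) := by
      fun_prop
    have hge : ∀ y ∈ closure Ω, ∀ s, M + K * Real.exp (ε⁻¹ * (s - (t + 1))) ≤ quadBarrier n x₀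
        (fun s : ℝ => M + ε * D + K * Real.exp (ε⁻¹ * (s - (t + 1)))) (fun _ => -ε) (y, s) := by
      intro y hy s
      have := mul_le_mul_of_nonneg_left (hD y hy).2 hε.le
      simp only [quadBarrier]
      linarith
    have hge' : ∀ y ∈ closure Ω, ∀ s, M ≤ quadBarrier n x₀
        (fun s : ℝ => M + ε * D + K * Real.exp (ε⁻¹ * (s - (t + 1)))) (fun _ => -ε) (y, s) :=
      fun y hy s => (le_add_of_nonneg_right (by positivity)).trans (hge y hy s)
    have h := hsub.le_of_boundary hΩo hΩb hu (S := t + 1)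
      (paraTestFn_quadBarrier x₀ ha contDiff_const) (continuous_quadBarrier x₀ ha contDiff_const)
      (fun y hy => (hbot y hy).trans (hge' y hy 0)) (fun y hy => ?_)
      (fun y hy s hs => (hlat y hy s hs.1).trans (hge' y (frontier_subset_closure hy) s))
      (fun q hq _ => ?_) (x, t) ⟨hx, ht, by simp⟩
    · refine h.trans ?_
      have h1 : Real.exp (ε⁻¹ * (t - (t + 1))) ≤ ε := by
        have h2 : ε⁻¹ ≤ Real.exp ε⁻¹ := by linarith [Real.add_one_le_exp ε⁻¹]
        rw [show ε⁻¹ * (t - (t + 1)) = -ε⁻¹ by ring, Real.exp_neg]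
        exact inv_le_of_inv_le₀ hε h2
      have h3 := mul_le_mul_of_nonneg_left h1 hK0
      have h4 : 0 ≤ ε * ‖x - x₀‖ ^ 2 := by positivity
      simp only [quadBarrier]
      linarith
    · refine (hK' (y, t + 1) ⟨hy, by linarith, le_rfl⟩).trans (le_trans ?_ (hge y hy _))
      simpa using hM
    · have hd : HasDerivAt (fun s : ℝ => M + ε * D + K * Real.exp (ε⁻¹ * (s - (t + 1))))
          (K * (Real.exp (ε⁻¹ * (q.2 - (t + 1))) * (ε⁻¹ * 1))) q.2 :=
        (((((hasDerivAt_id q.2).sub_const (t + 1)).const_mul ε⁻¹).exp).const_mul K).const_add _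
      rw [timeDeriv_quadBarrier x₀ hd (hasDerivAt_const _ _)]
      have hl := pLap_quad_le hn hp (M + ε * D + K * Real.exp (ε⁻¹ * (q.2 - (t + 1)))) hε
        (le_refl (-ε)) (hD q.1 (subset_closure hq.1)).1
      change pSpaceLap n p (quadBarrier n x₀
        (fun s : ℝ => M + ε * D + K * Real.exp (ε⁻¹ * (s - (t + 1)))) (fun _ => -ε)) q ≤ _ at hl
      have hn' : (2 : ℝ) ≤ n := by exact_mod_cast hn
      have h1 : 0 < 2 * ε * (n + p - 2) * (2 * ε) ^ (p - 2) := by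
        have : 0 < n + p - 2 := by linarith
        positivity
      have hu0 : 0 < u q := hupos q ⟨subset_closure hq.1, hq.2.1.le⟩
      have h2 : 0 ≤ (p - 1) * u q ^ (p - 2) *
          (K * (Real.exp (ε⁻¹ * (q.2 - (t + 1))) * (ε⁻¹ * 1)) + 0 * ‖q.1 - x₀‖ ^ 2) := by
        have : 0 ≤ p - 1 := by linarith
        positivity
      linarith
  refine le_of_forall_pos_le_add fun η hη => ?_
  have hpos : 0 < D + K + 1 := by positivity
  refine (key (η / (D + K + 1)) (by positivity)).trans ?_
  have : η / (D + K + 1) * (D + K) ≤ η := by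
    rw [div_mul_eq_mul_div, div_le_iff₀ hpos]
    nlinarith
  linarith

end Comparison

section Decay

/-- The time profile of the barriers: equal to `ε` at time `T`, to `ε + M` at times `0`, `2T`. -/
noncomputable def parabolaProfile (ε M T t : ℝ) : ℝ := ε + M * (t / T - 1) ^ 2

variable {ε M T : ℝ}

lemma contDiff_parabolaProfile : ContDiff ℝ 1 (parabolaProfile ε M T) := by
  unfold parabolaProfile
  fun_prop

lemma hasDerivAt_parabolaProfile (t : ℝ) :
    HasDerivAt (parabolaProfile ε M T) (M * (2 * (t / T - 1)) / T) t := by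
  have h := ((((hasDerivAt_id t).div_const T).sub_const 1).pow 2).const_mul M |>.const_add ε
  refine h.congr_deriv ?_
  simp
  ring

lemma le_parabolaProfile (hM : 0 ≤ M) (t : ℝ) : ε ≤ parabolaProfile ε M T t :=
  le_add_of_nonneg_right (by positivity)

lemma abs_deriv_parabolaProfile_le (hM : 0 ≤ M) (hT : 0 < T) {t : ℝ} (ht : t ∈ Ioo 0 (2 * T)) :
    |M * (2 * (t / T - 1)) / T| ≤ 2 * M / T := by
  have h1 : |t / T - 1| ≤ 1 := by
    rw [abs_le]
    constructor
    · linarith [div_pos ht.1 hT]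
    · linarith [(div_lt_iff₀ hT).mpr ht.2]
  rw [abs_div, abs_mul, abs_mul, abs_of_nonneg hM, abs_two, abs_of_pos hT]
  rw [mul_comm 2 M]
  gcongr
  linarith

lemma parabolaProfile_self (hT : 0 < T) : parabolaProfile ε M T T = ε := by
  simp [parabolaProfile, div_self hT.ne']

lemma parabolaProfile_zero : parabolaProfile ε M T 0 = ε + M := by
  simp [parabolaProfile]

lemma parabolaProfile_two_mul (hT : 0 < T) : parabolaProfile ε M T (2 * T) = ε + M := by
  have : 2 * T / T - 1 = 1 := by field_simp; norm_num
  simp [parabolaProfile, this]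

variable {n : ℕ} {p : ℝ} {Ω : Set (EuclideanSpace ℝ (Fin n))}
  {u : EuclideanSpace ℝ (Fin n) × ℝ → ℝ} {x₀ : EuclideanSpace ℝ (Fin n)} {D : ℝ}

/-- The time derivative term of the barriers is dominated by `2 (p-1) M^{p-1} (D+1) / T`. -/
lemma abs_time_term_le (hp : 2 ≤ p) (hM : 0 ≤ M) (hT : 0 < T)
    (hD : ∀ x ∈ closure Ω, 1 ≤ ‖x - x₀‖ ∧ ‖x - x₀‖ ^ 2 ≤ D)
    {q : EuclideanSpace ℝ (Fin n) × ℝ} (hq : q ∈ Ω ×ˢ Ioo 0 (2 * T)) (hu0 : 0 < u q)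
    (huM : u q ≤ M) :
    |(p - 1) * u q ^ (p - 2) * (M * (2 * (q.2 / T - 1)) / T * (D + 1 - ‖q.1 - x₀‖ ^ 2))| ≤
      (p - 1) * M ^ (p - 2) * (2 * M / T * (D + 1)) := by
  have hx := (hD q.1 (subset_closure hq.1)).2
  have hp1 : 0 ≤ p - 1 := by linarith
  have h1 : |D + 1 - ‖q.1 - x₀‖ ^ 2| ≤ D + 1 := by
    rw [abs_of_nonneg (by linarith)]
    linarith [sq_nonneg ‖q.1 - x₀‖]
  have h2 := abs_deriv_parabolaProfile_le hM hT hq.2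
  have h3 : u q ^ (p - 2) ≤ M ^ (p - 2) := Real.rpow_le_rpow hu0.le huM (by linarith)
  rw [abs_mul, abs_mul, abs_mul (M * _ / T), abs_of_nonneg hp1,
    abs_of_nonneg (Real.rpow_nonneg hu0.le _)]
  gcongr

lemma TrudSub.le_one_add (hn : 2 ≤ n) (hp : 2 ≤ p)
    (hsub : TrudSub n p (pcyl n Ω (Ioi 0)) u) (hΩo : IsOpen Ω)
    (hΩb : Bornology.IsBounded Ω) (hu : ContinuousOn u (closure Ω ×ˢ Ici 0))
    (hupos : ∀ q ∈ closure Ω ×ˢ Ici (0 : ℝ), 0 < u q) (hM : 0 ≤ M)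
    (huM : ∀ q ∈ closure Ω ×ˢ Ici (0 : ℝ), u q ≤ M)
    (hlat : ∀ x ∈ frontier Ω, ∀ t : ℝ, 0 ≤ t → u (x, t) ≤ 1)
    (hD : ∀ x ∈ closure Ω, 1 ≤ ‖x - x₀‖ ∧ ‖x - x₀‖ ^ 2 ≤ D) (hε : 0 < ε) (hT : 0 < T)
    (hlarge : (p - 1) * M ^ (p - 2) * (2 * M / T * (D + 1)) <
      2 * ε * (n + p - 2) * (2 * ε) ^ (p - 2)) {x : EuclideanSpace ℝ (Fin n)}
    (hx : x ∈ closure Ω) : u (x, T) ≤ 1 + ε * (D + 1) := by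
  have hA : ContDiff ℝ 1 fun t => 1 + parabolaProfile ε M T t * (D + 1) :=
    contDiff_const.add (contDiff_parabolaProfile.mul contDiff_const)
  have hB : ContDiff ℝ 1 fun t => -parabolaProfile ε M T t := contDiff_parabolaProfile.neg
  have hge : ∀ y ∈ closure Ω, ∀ s, 1 + parabolaProfile ε M T s ≤
      quadBarrier n x₀ (fun t => 1 + parabolaProfile ε M T t * (D + 1))
        (fun t => -parabolaProfile ε M T t) (y, s) := by
    intro y hy s
    have := mul_le_mul_of_nonneg_left (hD y hy).2
      (hε.le.trans (le_parabolaProfile (T := T) hM s))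
    simp only [quadBarrier]
    linarith
  have h := hsub.le_of_boundary hΩo hΩb hu (S := 2 * T)
    (paraTestFn_quadBarrier x₀ hA hB) (continuous_quadBarrier x₀ hA hB)
    (fun y hy => ?_) (fun y hy => ?_) (fun y hy s hs => ?_)
    (fun q hq _ => ?_) (x, T) ⟨hx, hT.le, by linarith⟩
  · refine h.trans ?_
    have : 0 ≤ ε * ‖x - x₀‖ ^ 2 := by positivity
    simp only [quadBarrier, parabolaProfile_self hT]
    linarith
  · refine le_trans ?_ (hge y hy 0)
    rw [parabolaProfile_zero]
    linarith [huM (y, 0) ⟨hy, self_mem_Ici⟩]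
  · refine le_trans ?_ (hge y hy _)
    rw [parabolaProfile_two_mul hT]
    linarith [huM (y, 2 * T) ⟨hy, mem_Ici.mpr (by linarith)⟩]
  · refine (hlat y hy s hs.1).trans (le_trans ?_ (hge y (frontier_subset_closure hy) s))
    linarith [le_parabolaProfile (ε := ε) (T := T) hM s]
  · have hmem : q ∈ closure Ω ×ˢ Ici (0 : ℝ) := ⟨subset_closure hq.1, hq.2.1.le⟩
    have ht := abs_time_term_le hp hM hT hD hq (hupos q hmem) (huM q hmem)
    have hl := pLap_quad_le hn hp (1 + parabolaProfile ε M T q.2 * (D + 1)) hε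
      (neg_le_neg (le_parabolaProfile (T := T) hM q.2)) (hD q.1 hmem.1).1
    change pSpaceLap n p (quadBarrier n x₀ (fun t => 1 + parabolaProfile ε M T t * (D + 1))
        (fun t => -parabolaProfile ε M T t)) q ≤ _ at hl
    have hd := hasDerivAt_parabolaProfile (ε := ε) (M := M) (T := T) q.2
    rw [timeDeriv_quadBarrier x₀ ((hd.mul_const (D + 1)).const_add 1) hd.fun_neg]
    have := (abs_le.mp ht).1
    linarith

lemma TrudSuper.one_sub_le (hn : 2 ≤ n) (hp : 2 ≤ p)
    (hsuper : TrudSuper n p (pcyl n Ω (Ioi 0)) u) (hΩo : IsOpen Ω)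
    (hΩb : Bornology.IsBounded Ω) (hu : ContinuousOn u (closure Ω ×ˢ Ici 0))
    (hupos : ∀ q ∈ closure Ω ×ˢ Ici (0 : ℝ), 0 < u q) (hM : 1 ≤ M)
    (huM : ∀ q ∈ closure Ω ×ˢ Ici (0 : ℝ), u q ≤ M)
    (hlat : ∀ x ∈ frontier Ω, ∀ t : ℝ, 0 ≤ t → 1 ≤ u (x, t))
    (hD : ∀ x ∈ closure Ω, 1 ≤ ‖x - x₀‖ ∧ ‖x - x₀‖ ^ 2 ≤ D) (hε : 0 < ε) (hT : 0 < T)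
    (hlarge : (p - 1) * M ^ (p - 2) * (2 * M / T * (D + 1)) <
      2 * ε * (n + p - 2) * (2 * ε) ^ (p - 2)) {x : EuclideanSpace ℝ (Fin n)}
    (hx : x ∈ closure Ω) : 1 - ε * (D + 1) ≤ u (x, T) := by
  have hM0 : 0 ≤ M := zero_le_one.trans hM
  have hA : ContDiff ℝ 1 fun t => 1 - parabolaProfile ε M T t * (D + 1) :=
    contDiff_const.sub (contDiff_parabolaProfile.mul contDiff_const)
  have hB : ContDiff ℝ 1 (parabolaProfile ε M T) := contDiff_parabolaProfile
  have hle : ∀ y ∈ closure Ω, ∀ s,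
      quadBarrier n x₀ (fun t => 1 - parabolaProfile ε M T t * (D + 1))
        (parabolaProfile ε M T) (y, s) ≤ 1 - parabolaProfile ε M T s := by
    intro y hy s
    have := mul_le_mul_of_nonneg_left (hD y hy).2
      (hε.le.trans (le_parabolaProfile (T := T) hM0 s))
    simp only [quadBarrier]
    linarith
  have h := hsuper.le_of_boundary hΩo hΩb hu (S := 2 * T)
    (paraTestFn_quadBarrier x₀ hA hB)
    (continuous_quadBarrier x₀ hA hB)
    (fun y hy => ?_) (fun y hy => ?_) (fun y hy s hs => ?_)
    (fun q hq _ => ?_) (x, T) ⟨hx, hT.le, by linarith⟩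
  · refine le_trans ?_ h
    have : 0 ≤ ε * ‖x - x₀‖ ^ 2 := by positivity
    simp only [quadBarrier, parabolaProfile_self hT]
    linarith
  · refine (hle y hy 0).trans ?_
    rw [parabolaProfile_zero]
    linarith [hupos (y, 0) ⟨hy, self_mem_Ici⟩]
  · refine (hle y hy _).trans ?_
    rw [parabolaProfile_two_mul hT]
    linarith [hupos (y, 2 * T) ⟨hy, mem_Ici.mpr (by linarith)⟩]
  · refine ((hle y (frontier_subset_closure hy) s).trans ?_).trans (hlat y hy s hs.1)
    linarith [le_parabolaProfile (ε := ε) (T := T) hM0 s]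
  · have hmem : q ∈ closure Ω ×ˢ Ici (0 : ℝ) := ⟨subset_closure hq.1, hq.2.1.le⟩
    have ht := abs_time_term_le hp hM0 hT hD hq (hupos q hmem) (huM q hmem)
    have hl := le_pLap_quad hn hp (1 - parabolaProfile ε M T q.2 * (D + 1)) hε
      (le_parabolaProfile (T := T) hM0 q.2) (hD q.1 hmem.1).1
    change _ ≤ pSpaceLap n p (quadBarrier n x₀ (fun t => 1 - parabolaProfile ε M T t * (D + 1))
        (parabolaProfile ε M T)) q at hl
    have hd := hasDerivAt_parabolaProfile (ε := ε) (M := M) (T := T) q.2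
    rw [timeDeriv_quadBarrier x₀ ((hd.mul_const (D + 1)).const_sub 1) hd]
    have := (abs_le.mp ht).1
    linarith

end Decay

/-- Theorem 1.61: if `u` solves Trudinger's equation with initial data `f` trapping `1` and
lateral boundary data `1`, then `u(x,t) → 1` as `t → ∞` for every `x ∈ Ω`. -/
theorem stmt2 (n : ℕ) (hn : 2 ≤ n) (p : ℝ) (hp : 2 ≤ p)
    (Ω : Set (EuclideanSpace ℝ (Fin n))) (hΩo : IsOpen Ω) (hΩc : IsConnected Ω)
    (hΩb : Bornology.IsBounded Ω)
    (f : EuclideanSpace ℝ (Fin n) → ℝ)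
    (hf : ContinuousOn f (closure Ω))
    (hf0 : 0 < sInf (f '' Ω)) (hf1 : sInf (f '' Ω) ≤ 1)
    (hf2 : 1 ≤ sSup (f '' Ω)) (hf3 : BddAbove (f '' Ω))
    (u : EuclideanSpace ℝ (Fin n) × ℝ → ℝ)
    (hu : ContinuousOn u (pcyl n Ω (Set.Ioi 0) ∪ pbdry n Ω (Set.Ioi 0)))
    (hupos : ∀ q ∈ pcyl n Ω (Set.Ioi 0) ∪ pbdry n Ω (Set.Ioi 0), 0 < u q)
    (hsub : TrudSub n p (pcyl n Ω (Set.Ioi 0)) u)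
    (hsuper : TrudSuper n p (pcyl n Ω (Set.Ioi 0)) u)
    (hic : ∀ x ∈ closure Ω, u (x, 0) = f x)
    (hbc : ∀ x ∈ frontier Ω, ∀ t : ℝ, 0 ≤ t → u (x, t) = 1) :
    ∀ x ∈ Ω, Filter.Tendsto (fun t => u (x, t)) Filter.atTop (nhds 1) := by
  have hsubset := closure_prod_Ici_subset Ω
  have hu' : ContinuousOn u (closure Ω ×ˢ Ici 0) := hu.mono hsubset
  have hupos' : ∀ q ∈ closure Ω ×ˢ Ici (0 : ℝ), 0 < u q := fun q hq => hupos q (hsubset hq)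
  obtain ⟨M₀, hM₀⟩ := hΩb.isCompact_closure.bddAbove_image hf
  set M := max M₀ 1
  have hM1 : 1 ≤ M := le_max_right _ _
  have hM0 : 0 ≤ M := zero_le_one.trans hM1
  have huM : ∀ q ∈ closure Ω ×ˢ Ici (0 : ℝ), u q ≤ M := by
    refine hsub.le_of_parabolic_boundary hn hp hΩo hΩb hu' hupos' hM0 (fun x hx => ?_)
      (fun x hx t ht => (hbc x hx t ht).trans_le hM1)
    rw [hic x hx]
    exact (hM₀ (mem_image_of_mem f hx)).trans (le_max_left _ _)
  obtain ⟨x₀, D, hD⟩ := exists_center hn hΩb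
  intro x hx
  have hxc := subset_closure hx
  have hD0 : 0 ≤ D := (sq_nonneg _).trans (hD x hxc).2
  rw [Metric.tendsto_nhds]
  intro η hη
  set ε := η / (2 * (D + 1)) with hεdef
  have hε : 0 < ε := by positivity
  have hεη : ε * (D + 1) < η := by
    have : ε * (D + 1) = η / 2 := by rw [hεdef]; field_simp
    linarith
  have hn' : (2 : ℝ) ≤ n := by exact_mod_cast hn
  have hc : 0 < 2 * ε * (n + p - 2) * (2 * ε) ^ (p - 2) := by
    have : 0 < n + p - 2 := by linarith
    positivity
  have hlim : Tendsto (fun T : ℝ => (p - 1) * M ^ (p - 2) * (2 * M / T * (D + 1))) atTop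
      (nhds 0) := by
    have := ((tendsto_const_nhds (x := 2 * M)).div_atTop tendsto_id).mul_const (D + 1)
      |>.const_mul ((p - 1) * M ^ (p - 2))
    simpa using this
  filter_upwards [hlim.eventually_lt_const hc, eventually_gt_atTop 0] with T hlarge hT
  have h1 := hsub.le_one_add hn hp hΩo hΩb hu' hupos' hM0 huM
    (fun y hy t ht => (hbc y hy t ht).le) hD hε hT hlarge hxc
  have h2 := hsuper.one_sub_le hn hp hΩo hΩb hu' hupos' hM1 huM
    (fun y hy t ht => (hbc y hy t ht).ge) hD hε hT hlarge hxc
  rw [Real.dist_eq, abs_lt]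
  constructor <;> linarith
end

section
/- Let 2 ≤ p < ∞, n ≥ 2, T > 0, H = ℝⁿ and H_T = ℝⁿ×(0,T). Let f ∈ C(H) with 0 < inf_H f ≤ sup_H f < ∞. Suppose u ∈ C((H×{0}) ∪ H_T), u > 0, is a viscosity solution of Γ_p u = 0 in H_T with u(x,0) = f(x), and suppose that as R → ∞, sup_{0≤|x|≤R, 0≤t≤T} u(x,t) ≤ exp(o(R^{p/(p−1)})). Then inf_H f ≤ u(x,t) ≤ sup_H f for all (x,t) ∈ H_T. -/
open Set Filter
open scoped Classical

open Topology

theorem pLap_eq_of_two_le {n : ℕ} {p : ℝ} (hp : 2 ≤ p) (φ : EuclideanSpace ℝ (Fin n) → ℝ)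
    (x : EuclideanSpace ℝ (Fin n)) :
    pLap n p φ x = ‖gradient φ x‖ ^ (p - 2) *
        ∑ i : Fin n, iteratedFDeriv ℝ 2 φ x
          ![EuclideanSpace.single i (1 : ℝ), EuclideanSpace.single i (1 : ℝ)] +
      (p - 2) * ‖gradient φ x‖ ^ (p - 4) *
        iteratedFDeriv ℝ 2 φ x ![gradient φ x, gradient φ x] := by
  unfold pLap
  split_ifs with h1 h2
  · subst h2
    simp
  · have h0 : iteratedFDeriv ℝ 2 φ x ![gradient φ x, gradient φ x] = 0 :=
      (iteratedFDeriv ℝ 2 φ x).map_coord_zero 0 (by simpa using h1)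
    rw [h0, h1, norm_zero, Real.zero_rpow (sub_ne_zero.2 h2)]
    simp
  · rfl

theorem pLap_radial {n : ℕ} {p : ℝ} (hp : 2 ≤ p) {F F1 F2 : ℝ → ℝ}
    (h1 : ∀ r, 0 ≤ r → HasDerivAt F (F1 r) r) (h2 : ∀ r, 0 ≤ r → HasDerivAt F1 (F2 r) r)
    (x : EuclideanSpace ℝ (Fin n)) :
    pLap n p (fun x => F (‖x‖ ^ 2)) x = (2 * |F1 (‖x‖ ^ 2)| * ‖x‖) ^ (p - 2) *
      (2 * (n + p - 2) * F1 (‖x‖ ^ 2) + 4 * (p - 1) * ‖x‖ ^ 2 * F2 (‖x‖ ^ 2)) := by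
  have hsq : ∀ y : EuclideanSpace ℝ (Fin n),
      HasFDerivAt (fun x : EuclideanSpace ℝ (Fin n) => ‖x‖ ^ 2) (2 • innerSL ℝ y) y :=
    fun y => (hasStrictFDerivAt_norm_sq y).hasFDerivAt
  have hd : ∀ y : EuclideanSpace ℝ (Fin n), HasFDerivAt (fun x => F (‖x‖ ^ 2))
      ((2 * F1 (‖y‖ ^ 2)) • innerSL ℝ y) y := fun y => by
    have := (h1 (‖y‖ ^ 2) (by positivity)).comp_hasFDerivAt y (hsq y)
    exact this.congr_fderiv (by ext v; simp; ring)
  have hfd : fderiv ℝ (fun x : EuclideanSpace ℝ (Fin n) => F (‖x‖ ^ 2)) =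
      fun y => (2 * F1 (‖y‖ ^ 2)) • innerSL ℝ y := funext fun y => (hd y).fderiv
  have hg : gradient (fun x => F (‖x‖ ^ 2)) x = (2 * F1 (‖x‖ ^ 2)) • x := by
    unfold gradient
    rw [hfd, LinearIsometryEquiv.symm_apply_eq]
    ext v
    simp
  have hit : ∀ v w, iteratedFDeriv ℝ 2 (fun x : EuclideanSpace ℝ (Fin n) => F (‖x‖ ^ 2)) x
      ![v, w] = 2 * F1 (‖x‖ ^ 2) * inner ℝ v w +
        4 * F2 (‖x‖ ^ 2) * inner ℝ x v * inner ℝ x w := fun v w => by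
    rw [iteratedFDeriv_two_apply, hfd]
    have hc : HasFDerivAt (fun y : EuclideanSpace ℝ (Fin n) => 2 * F1 (‖y‖ ^ 2))
        ((4 * F2 (‖x‖ ^ 2)) • innerSL ℝ x) x := by
      have := ((h2 (‖x‖ ^ 2) (by positivity)).comp_hasFDerivAt x (hsq x)).const_mul 2
      exact this.congr_fderiv (by ext v; simp; ring)
    have hi : HasFDerivAt (fun y : EuclideanSpace ℝ (Fin n) => innerSL ℝ y) (innerSL ℝ) x :=
      (innerSL ℝ).hasFDerivAt
    have hm : HasFDerivAt (fun y : EuclideanSpace ℝ (Fin n) => (2 * F1 (‖y‖ ^ 2)) • innerSL ℝ y)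
        _ x := hc.smul hi
    rw [hm.fderiv]
    simp
    exact Or.inl rfl
  have hnorm : ‖(2 * F1 (‖x‖ ^ 2)) • x‖ = 2 * |F1 (‖x‖ ^ 2)| * ‖x‖ := by
    rw [norm_smul, Real.norm_eq_abs, abs_mul, abs_two]
  have hsum : ∑ i : Fin n, iteratedFDeriv ℝ 2 (fun x : EuclideanSpace ℝ (Fin n) => F (‖x‖ ^ 2)) x
      ![EuclideanSpace.single i (1 : ℝ), EuclideanSpace.single i (1 : ℝ)] =
      2 * n * F1 (‖x‖ ^ 2) + 4 * ‖x‖ ^ 2 * F2 (‖x‖ ^ 2) := by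
    have hx : ∑ i, x i * x i = ‖x‖ ^ 2 := by
      rw [EuclideanSpace.real_norm_sq_eq]
      exact Finset.sum_congr rfl fun i _ => (sq _).symm
    simp only [hit, Finset.sum_add_distrib, mul_assoc, ← Finset.mul_sum]
    simp [EuclideanSpace.inner_single_right, hx]
    ring
  rw [pLap_eq_of_two_le hp, hsum, hg, hit, hnorm]
  set a := F1 (‖x‖ ^ 2)
  set b := F2 (‖x‖ ^ 2)
  simp only [inner_smul_left, inner_smul_right, real_inner_self_eq_norm_sq]
  simp only [conj_trivial]
  set g := 2 * |a| * ‖x‖ with hgdef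
  have hg2 : g ^ 2 = 4 * a ^ 2 * ‖x‖ ^ 2 := by
    rw [hgdef, mul_pow, mul_pow, sq_abs]
    ring
  have key : (p - 2) * (g ^ (p - 4) * g ^ 2) = (p - 2) * g ^ (p - 2) := by
    rcases eq_or_ne p 2 with h | h
    · simp [h]
    · rcases (show 0 ≤ g by positivity).eq_or_lt with h0 | h0
      · rw [← h0, Real.zero_rpow (sub_ne_zero.2 h)]
        simp
      · rw [← Real.rpow_natCast g 2, ← Real.rpow_add h0]
        norm_num
        left
        ring_nf
  have : (p - 2) * g ^ (p - 4) *
      (2 * a * (2 * a * (2 * a * ‖x‖ ^ 2)) + 4 * b * (2 * a * ‖x‖ ^ 2) * (2 * a * ‖x‖ ^ 2)) =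
      (p - 2) * (g ^ (p - 4) * g ^ 2) * (2 * a + 4 * b * ‖x‖ ^ 2) := by
    rw [hg2]
    ring
  rw [this, key]
  ring

/-- Either `v ≤ w` on a closed cylinder, or some multiple of `w` touches `v` from above at an
interior point, provided that `v ≤ w` on the bottom, the top and the lateral boundary. -/
theorem le_or_exists_touching {E : Type*} [NormedAddCommGroup E] [ProperSpace E] {R T : ℝ}
    {v w : E × ℝ → ℝ}
    (hv : ContinuousOn v (Metric.closedBall 0 R ×ˢ Icc 0 T))
    (hw : ContinuousOn w (Metric.closedBall 0 R ×ˢ Icc 0 T))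
    (hw0 : ∀ q ∈ (Metric.closedBall (0 : E) R ×ˢ Icc 0 T), 0 < w q)
    (hbot : ∀ x, ‖x‖ ≤ R → v (x, 0) ≤ w (x, 0))
    (htop : ∀ x, ‖x‖ ≤ R → v (x, T) ≤ w (x, T))
    (hlat : ∀ x, ∀ t ∈ Icc 0 T, ‖x‖ = R → v (x, t) ≤ w (x, t)) :
    (∀ x, ∀ t ∈ Icc 0 T, ‖x‖ ≤ R → v (x, t) ≤ w (x, t)) ∨
      ∃ x, ∃ t ∈ Ioo 0 T, ∃ θ > 1, ‖x‖ < R ∧ v (x, t) = θ * w (x, t) ∧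
        ∀ᶠ q in 𝓝 (x, t), v q ≤ θ * w q := by
  by_contra! hcon
  obtain ⟨⟨x₀, t₀, ht₀, hx₀, hlt⟩, hno⟩ := hcon
  have hmem : (x₀, t₀) ∈ Metric.closedBall (0 : E) R ×ˢ Icc 0 T := ⟨by simpa using hx₀, ht₀⟩
  obtain ⟨⟨x, t⟩, hq, hmax⟩ := ((isCompact_closedBall (0 : E) R).prod isCompact_Icc).exists_isMaxOn
    ⟨_, hmem⟩ (hv.div hw fun q hq => (hw0 q hq).ne')
  have hwq := hw0 _ hq
  have hθ : 1 < v (x, t) / w (x, t) :=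
    ((one_lt_div (hw0 _ hmem)).2 hlt).trans_le (hmax hmem)
  have hgt : w (x, t) < v (x, t) := (one_lt_div hwq).1 hθ
  have hxR : ‖x‖ ≤ R := by simpa using hq.1
  have hxlt : ‖x‖ < R := hxR.lt_of_ne fun h => (hlat x t hq.2 h).not_gt hgt
  have ht0 : 0 < t := hq.2.1.lt_of_ne fun h => (hbot x hxR).not_gt (h ▸ hgt)
  have htT : t < T := hq.2.2.lt_of_ne fun h => (htop x hxR).not_gt (h ▸ hgt)
  refine hno x t ⟨ht0, htT⟩ _ hθ hxlt (by field_simp) ?_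
  have hnhds : Metric.closedBall (0 : E) R ×ˢ Icc 0 T ∈ 𝓝 (x, t) :=
    prod_mem_nhds (Metric.closedBall_mem_nhds_of_mem (by simpa using hxlt)) (Icc_mem_nhds ht0 htT)
  filter_upwards [hnhds] with q hq'
  exact not_lt.2 ((div_le_iff₀ (hw0 q hq')).1 (hmax hq'))

theorem exists_le_mul_exp {δ s : ℝ} (hδ : 0 < δ) (hs : 0 < s) (C : ℝ) :
    ∃ N > 0, C ≤ δ * Real.exp (N * s) := by
  have h : Tendsto (fun N : ℝ => δ * Real.exp (N * s)) atTop atTop :=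
    (Real.tendsto_exp_atTop.comp (tendsto_id.atTop_mul_const hs)).const_mul_atTop hδ
  obtain ⟨N, h1, h2⟩ := ((eventually_gt_atTop 0).and (h.eventually_ge_atTop C)).exists
  exact ⟨N, h1, h2⟩

theorem pLap_exp_barrier_le {n : ℕ} (hn : 2 ≤ n) {p σ b C : ℝ} (hp : 2 ≤ p)
    (hσ : σ = p / (p - 1) / 2) (hC : 0 < C) (hb : 0 < b) (hb2 : b ≤ 1 / 2)
    (x : EuclideanSpace ℝ (Fin n)) :
    pLap n p (fun x => C * Real.exp (b * (1 + ‖x‖ ^ 2) ^ σ)) x ≤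
      (2 * (n + p - 2) + 2 * (p - 1)) * b * (1 + ‖x‖ ^ 2) ^ σ *
        (C * Real.exp (b * (1 + ‖x‖ ^ 2) ^ σ)) ^ (p - 1) := by
  have hn' : (2 : ℝ) ≤ n := by exact_mod_cast hn
  have hp1 : 0 < p - 1 := by linarith
  have hσp : σ * (2 * (p - 1)) = p := by rw [hσ]; field_simp
  have hσ0 : 0 < σ := by rw [hσ]; positivity
  have hσ1 : σ ≤ 1 := by nlinarith
  have hpow : ∀ s r : ℝ, 0 ≤ r →
      HasDerivAt (fun r : ℝ => (1 + r) ^ s) (s * (1 + r) ^ (s - 1)) r := fun s r hr => by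
    simpa using ((hasDerivAt_id r).const_add 1).rpow_const (p := s) (Or.inl (by simp; positivity))
  have hF : ∀ r : ℝ, 0 ≤ r → HasDerivAt (fun r => C * Real.exp (b * (1 + r) ^ σ))
      (C * Real.exp (b * (1 + r) ^ σ) * (b * σ * (1 + r) ^ (σ - 1))) r := fun r hr =>
    ((((hpow σ r hr).const_mul b).exp).const_mul C).congr_deriv (by ring)
  have hF1 : ∀ r : ℝ, 0 ≤ r →
      HasDerivAt (fun r => C * Real.exp (b * (1 + r) ^ σ) * (b * σ * (1 + r) ^ (σ - 1)))
      (C * Real.exp (b * (1 + r) ^ σ) * ((b * σ * (1 + r) ^ (σ - 1)) ^ 2 -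
        b * σ * (1 - σ) * (1 + r) ^ (σ - 1 - 1))) r := fun r hr =>
    ((hF r hr).mul ((hpow (σ - 1) r hr).const_mul (b * σ))).congr_deriv (by ring)
  rw [pLap_radial hp hF hF1]
  set y := 1 + ‖x‖ ^ 2 with hy
  set G := C * Real.exp (b * y ^ σ) with hG
  have hG0 : 0 < G := by positivity
  have hy1 : 1 ≤ y := by rw [hy]; nlinarith [sq_nonneg ‖x‖]
  have hy0 : 0 < y := by linarith
  have hxy : ‖x‖ ≤ y ^ (1 / 2 : ℝ) := by
    rw [← Real.sqrt_eq_rpow]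
    exact Real.le_sqrt_of_sq_le (by rw [hy]; linarith)
  set h := b * σ * y ^ (σ - 1) with hh
  have hh0 : 0 < h := by positivity
  have hhb : h ≤ b * y ^ (σ - 1) := by
    rw [hh]
    exact mul_le_mul_of_nonneg_right (by nlinarith) (by positivity)
  have hyh : y * h ^ 2 ≤ b / 2 * y ^ (2 * σ - 1) := by
    have e : y ^ (2 * σ - 1) = y * (y ^ (σ - 1)) ^ 2 := by
      rw [← Real.rpow_natCast (y ^ (σ - 1)), ← Real.rpow_mul hy0.le]
      nth_rewrite 2 [← Real.rpow_one y]
      rw [← Real.rpow_add hy0]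
      congr 1
      push_cast
      ring
    rw [e]
    calc y * h ^ 2 ≤ y * (b * y ^ (σ - 1)) ^ 2 := by gcongr
      _ = b * b * (y * (y ^ (σ - 1)) ^ 2) := by ring
      _ ≤ b / 2 * (y * (y ^ (σ - 1)) ^ 2) := by gcongr; nlinarith
  have hgrad : 2 * |G * h| * ‖x‖ ≤ G * y ^ (σ - 1 / 2) := by
    have e : y ^ (σ - 1 / 2) = y ^ (σ - 1) * y ^ (1 / 2 : ℝ) := by
      rw [← Real.rpow_add hy0]
      congr 1
      ring
    rw [abs_of_pos (by positivity), e]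
    calc 2 * (G * h) * ‖x‖ ≤ 2 * (G * (1 / 2 * y ^ (σ - 1))) * y ^ (1 / 2 : ℝ) := by
          gcongr
          exact hhb.trans (by gcongr)
      _ = _ := by ring
  have hbr : 2 * (n + p - 2) * (G * h) + 4 * (p - 1) * ‖x‖ ^ 2 *
      (G * (h ^ 2 - b * σ * (1 - σ) * y ^ (σ - 1 - 1))) ≤
      G * b * (2 * (n + p - 2) * y ^ (σ - 1) + 2 * (p - 1) * y ^ (2 * σ - 1)) := by
    have hx2 : ‖x‖ ^ 2 ≤ y := by rw [hy]; linarith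
    have hnn : 0 ≤ b * σ * (1 - σ) * y ^ (σ - 1 - 1) := by
      have : 0 ≤ 1 - σ := by linarith
      positivity
    have hnp : 0 ≤ n + p - 2 := by linarith
    calc _ ≤ 2 * (n + p - 2) * (G * (b * y ^ (σ - 1))) + 4 * (p - 1) * ‖x‖ ^ 2 * (G * h ^ 2) := by
          gcongr
          linarith
      _ ≤ 2 * (n + p - 2) * (G * (b * y ^ (σ - 1))) + 4 * (p - 1) * y * (G * h ^ 2) := by
          gcongr
      _ = 2 * (n + p - 2) * (G * (b * y ^ (σ - 1))) + 4 * (p - 1) * G * (y * h ^ 2) := by ring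
      _ ≤ 2 * (n + p - 2) * (G * (b * y ^ (σ - 1))) +
          4 * (p - 1) * G * (b / 2 * y ^ (2 * σ - 1)) := by gcongr
      _ = _ := by ring
  have hnp : 0 ≤ n + p - 2 := by linarith
  calc _ ≤ (G * y ^ (σ - 1 / 2)) ^ (p - 2) *
        (G * b * (2 * (n + p - 2) * y ^ (σ - 1) + 2 * (p - 1) * y ^ (2 * σ - 1))) := by
        refine (mul_le_mul_of_nonneg_left hbr (by positivity)).trans ?_
        exact mul_le_mul_of_nonneg_right
          (Real.rpow_le_rpow (by positivity) hgrad (by linarith)) (by positivity)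
    _ = b * (2 * (n + p - 2) * y ^ ((σ - 1 / 2) * (p - 2) + (σ - 1)) +
          2 * (p - 1) * y ^ ((σ - 1 / 2) * (p - 2) + (2 * σ - 1))) * G ^ (p - 1) := by
        have e : G ^ (p - 1) = G ^ (p - 2) * G := by
          rw [← Real.rpow_add_one hG0.ne']
          congr 1
          ring
        rw [Real.mul_rpow hG0.le (by positivity), ← Real.rpow_mul hy0.le, Real.rpow_add hy0,
          Real.rpow_add hy0, e]
        ring
    _ ≤ b * (2 * (n + p - 2) * y ^ σ + 2 * (p - 1) * y ^ σ) * G ^ (p - 1) := by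
        gcongr
        · nlinarith
        · nlinarith
    _ = _ := by ring

theorem exists_le_pLap_bump (n : ℕ) {p : ℝ} (hp : 2 ≤ p) (hn : 2 ≤ n) :
    ∃ K > 0, ∀ R ≥ 1, ∀ c > 0, ∀ x : EuclideanSpace ℝ (Fin n), ‖x‖ < R →
      -(K / R ^ 2 * (c * (1 - ‖x‖ ^ 2 / R ^ 2) ^ 2) ^ (p - 1)) ≤
        pLap n p (fun x => c * (1 - ‖x‖ ^ 2 / R ^ 2) ^ 2) x := by
  have hn' : (2 : ℝ) ≤ n := by exact_mod_cast hn
  have hp1 : 0 < p - 1 := by linarith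
  have hnp : 0 < n + p - 2 := by linarith
  have hd : 0 < n + 3 * p - 4 := by linarith
  set z₀ := 2 * (p - 1) / (n + 3 * p - 4) with hz₀
  have hz0 : 0 < z₀ := by positivity
  refine ⟨4 ^ (p - 1) * (n + p - 2) / (z₀ ^ 2) ^ (p - 1), by positivity, ?_⟩
  intro R hR c hc x hx
  have hR0 : 0 < R := by linarith
  have hz' : ∀ r : ℝ, HasDerivAt (fun r => 1 - r / R ^ 2) (-(1 / R ^ 2)) r := fun r =>
    ((hasDerivAt_id r).div_const _).const_sub 1
  have hF : ∀ r : ℝ, 0 ≤ r → HasDerivAt (fun r => c * (1 - r / R ^ 2) ^ 2)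
      (-(2 * c / R ^ 2) * (1 - r / R ^ 2)) r := fun r _ =>
    (((hz' r).pow 2).const_mul c).congr_deriv (by simp; ring)
  have hF1 : ∀ r : ℝ, 0 ≤ r → HasDerivAt (fun r => -(2 * c / R ^ 2) * (1 - r / R ^ 2))
      (2 * c / R ^ 4) r := fun r _ =>
    ((hz' r).const_mul _).congr_deriv (by field_simp)
  rw [pLap_radial hp hF hF1]
  set z := 1 - ‖x‖ ^ 2 / R ^ 2 with hz
  have hzpos : 0 < z := by
    have : ‖x‖ ^ 2 / R ^ 2 < 1 := by
      rw [div_lt_one (by positivity)]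
      gcongr
    linarith
  have hz1 : z ≤ 1 := by
    have : 0 ≤ ‖x‖ ^ 2 / R ^ 2 := by positivity
    linarith
  have hx2 : ‖x‖ ^ 2 = (1 - z) * R ^ 2 := by rw [hz]; field_simp; ring
  have hbr : 2 * (n + p - 2) * (-(2 * c / R ^ 2) * z) + 4 * (p - 1) * ‖x‖ ^ 2 * (2 * c / R ^ 4) =
      4 * c / R ^ 2 * (2 * (p - 1) - (n + 3 * p - 4) * z) := by
    rw [hx2]
    field_simp
    ring
  rw [hbr]
  set g := 2 * |-(2 * c / R ^ 2) * z| * ‖x‖ with hg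
  have hg0 : 0 ≤ g := by positivity
  rcases le_total z z₀ with hle | hle
  · have h1 : 0 ≤ 2 * (p - 1) - (n + 3 * p - 4) * z := by
      have := (le_div_iff₀ hd).1 hle
      linarith
    have h2 : 0 ≤ g ^ (p - 2) * (4 * c / R ^ 2 * (2 * (p - 1) - (n + 3 * p - 4) * z)) := by
      positivity
    refine le_trans ?_ h2
    rw [neg_nonpos]
    positivity
  · have hg4 : g ≤ 4 * c := by
      have : g = 4 * c * z * (‖x‖ / R) / R := by
        rw [hg, abs_mul, abs_neg, abs_of_pos hzpos, abs_of_pos (by positivity)]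
        field_simp
        ring
      rw [this]
      have h1 : ‖x‖ / R ≤ 1 := (div_le_one hR0).2 hx.le
      rw [div_le_iff₀ hR0]
      calc 4 * c * z * (‖x‖ / R) ≤ 4 * c * 1 * 1 := by gcongr
        _ ≤ 4 * c * R := by nlinarith
    have hgp : g ^ (p - 2) ≤ (4 * c) ^ (p - 2) := Real.rpow_le_rpow hg0 hg4 (by linarith)
    have e : (4 * c) ^ (p - 1) = (4 * c) ^ (p - 2) * (4 * c) := by
      rw [← Real.rpow_add_one (by positivity)]
      congr 1
      ring
    have h3 : -(n + p - 2) ≤ 2 * (p - 1) - (n + 3 * p - 4) * z := by nlinarith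
    have h4 : (z₀ ^ 2) ^ (p - 1) ≤ (z ^ 2) ^ (p - 1) := by gcongr
    calc _ ≤ -((4 * c) ^ (p - 2) * (4 * c / R ^ 2 * (n + p - 2))) := by
          rw [neg_le_neg_iff, Real.mul_rpow hc.le (by positivity)]
          calc _ = (4 * c) ^ (p - 1) * (n + p - 2) / R ^ 2 * 1 := by rw [e]; ring
            _ ≤ (4 * c) ^ (p - 1) * (n + p - 2) / R ^ 2 *
                ((z ^ 2) ^ (p - 1) / (z₀ ^ 2) ^ (p - 1)) := by
                gcongr
                exact (one_le_div (by positivity)).2 h4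
            _ = _ := by rw [Real.mul_rpow (by norm_num) hc.le]; ring
      _ ≤ -(g ^ (p - 2) * (4 * c / R ^ 2 * (n + p - 2))) := by gcongr
      _ = g ^ (p - 2) * (4 * c / R ^ 2 * -(n + p - 2)) := by ring
      _ ≤ _ := by gcongr

section

variable {n : ℕ} {p T : ℝ} {u : EuclideanSpace ℝ (Fin n) × ℝ → ℝ}

theorem closedBall_prod_Icc_subset {E : Type*} [NormedAddCommGroup E] {R T' : ℝ} (hT' : T' < T) :
    (Metric.closedBall (0 : E) R ×ˢ Icc 0 T') ⊆ (univ ×ˢ {(0 : ℝ)}) ∪ (univ ×ˢ Ioo (0 : ℝ) T) := by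
  rintro ⟨x, t⟩ ⟨-, h0, h1⟩
  rcases h0.eq_or_lt with h | h
  · exact Or.inl ⟨mem_univ _, h.symm⟩
  · exact Or.inr ⟨mem_univ _, h, h1.trans_lt hT'⟩

theorem TrudSub.le_barrier (hn : 2 ≤ n) (hp : 2 ≤ p)
    (hu : ContinuousOn u ((univ ×ˢ {(0 : ℝ)}) ∪ (univ ×ˢ Ioo (0 : ℝ) T)))
    (hsub : TrudSub n p (univ ×ˢ Ioo (0 : ℝ) T) u)
    {M : ℝ} (hM : 0 < M) (hbot : ∀ x, u (x, 0) ≤ M)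
    (hgrowth : ∀ ε > (0 : ℝ), ∃ R₀ : ℝ, ∀ R ≥ R₀, ∀ x : EuclideanSpace ℝ (Fin n), ∀ t : ℝ,
      ‖x‖ ≤ R → 0 ≤ t → t ≤ T → u (x, t) ≤ Real.exp (ε * R ^ (p / (p - 1))))
    {σ K ε : ℝ} (hσ : σ = p / (p - 1) / 2) (hK : K = 2 * (n + p - 2) + 2 * (p - 1))
    (hε : 0 < ε) (hεK : ε * Real.exp (K * T) ≤ 1 / 2)
    (x₀ : EuclideanSpace ℝ (Fin n)) {t₀ : ℝ} (ht₀ : t₀ ∈ Ioo 0 T) :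
    u (x₀, t₀) ≤ M * Real.exp ε * Real.exp (ε * Real.exp (K * t₀) * (1 + ‖x₀‖ ^ 2) ^ σ) := by
  have hn' : (2 : ℝ) ≤ n := by exact_mod_cast hn
  have hp1 : 0 < p - 1 := by linarith
  have hK0 : 0 < K := by rw [hK]; linarith
  obtain ⟨T', ht₀', hT'⟩ := exists_between ht₀.2
  have hT'0 : 0 < T' := ht₀.1.trans ht₀'
  obtain ⟨R₀, hR₀⟩ := hgrowth (ε / 2) (by positivity)
  have hlim : Tendsto (fun R : ℝ => M * Real.exp (ε / 2 * R ^ (p / (p - 1)))) atTop atTop :=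
    (Real.tendsto_exp_atTop.comp
      ((tendsto_rpow_atTop (by positivity)).const_mul_atTop (by positivity))).const_mul_atTop hM
  obtain ⟨R, hRR₀, hRx, hRM⟩ := ((eventually_ge_atTop R₀).and
    ((eventually_ge_atTop ‖x₀‖).and (hlim.eventually_ge_atTop 1))).exists
  have hR0 : 0 ≤ R := (norm_nonneg _).trans hRx
  have hQ := closedBall_prod_Icc_subset (E := EuclideanSpace ℝ (Fin n)) (R := R) hT'
  obtain ⟨C, hC⟩ := ((isCompact_closedBall (0 : EuclideanSpace ℝ (Fin n)) R).prod
    (isCompact_Icc (a := 0) (b := T'))).bddAbove_image (hu.mono hQ)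
  obtain ⟨N, hN, hNC⟩ := exists_le_mul_exp hε (sub_pos.2 ht₀') (C / M)
  set w : EuclideanSpace ℝ (Fin n) × ℝ → ℝ := fun q =>
    M * Real.exp (ε * Real.exp (N * (q.2 - t₀))) *
      Real.exp (ε * Real.exp (K * q.2) * (1 + ‖q.1‖ ^ 2) ^ σ) with hw
  have hy0 : ∀ x : EuclideanSpace ℝ (Fin n), 1 + ‖x‖ ^ 2 ≠ 0 := fun x => by positivity
  have hPcont : ContDiff ℝ 2 fun x : EuclideanSpace ℝ (Fin n) => (1 + ‖x‖ ^ 2) ^ σ :=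
    (contDiff_const.add (contDiff_norm_sq ℝ)).rpow_const_of_ne hy0
  have hwcont : Continuous w := by
    have h1 : Continuous fun q : EuclideanSpace ℝ (Fin n) × ℝ =>
        M * Real.exp (ε * Real.exp (N * (q.2 - t₀))) := by fun_prop
    have h2 : Continuous fun q : EuclideanSpace ℝ (Fin n) × ℝ => ε * Real.exp (K * q.2) := by
      fun_prop
    exact h1.mul (h2.mul (hPcont.continuous.comp continuous_fst)).rexp
  have hMw : ∀ q, M ≤ w q := fun q => by
    calc M = M * 1 * 1 := by ring
      _ ≤ _ := by simp only [hw]; gcongr <;> exact Real.one_le_exp (by positivity)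
  have htest : ∀ θ, ParaTestFn n fun q => θ * w q := fun θ =>
    ⟨fun t => by simp only [hw]; fun_prop, fun x => by simp only [hw]; fun_prop⟩
  have htop : ∀ x, ‖x‖ ≤ R → u (x, T') ≤ w (x, T') := fun x hx => by
    have h1 : u (x, T') ≤ C := hC ⟨(x, T'), ⟨by simpa using hx, hT'0.le, le_rfl⟩, rfl⟩
    have h2 : C ≤ M * (ε * Real.exp (N * (T' - t₀))) := (div_le_iff₀' hM).1 hNC
    have h3 : ε * Real.exp (N * (T' - t₀)) ≤ Real.exp (ε * Real.exp (N * (T' - t₀))) := by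
      linarith [Real.add_one_le_exp (ε * Real.exp (N * (T' - t₀)))]
    calc u (x, T') ≤ M * (ε * Real.exp (N * (T' - t₀))) := h1.trans h2
      _ ≤ M * Real.exp (ε * Real.exp (N * (T' - t₀))) * 1 := by rw [mul_one]; gcongr
      _ ≤ _ := by
        simp only [hw]
        gcongr
        exact Real.one_le_exp (by positivity)
  have hlat : ∀ x, ∀ t ∈ Icc 0 T', ‖x‖ = R → u (x, t) ≤ w (x, t) := fun x t ht hx => by
    have hPR : R ^ (p / (p - 1)) ≤ (1 + ‖x‖ ^ 2) ^ σ := by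
      have : R ^ (p / (p - 1)) = (R ^ 2) ^ σ := by
        rw [← Real.rpow_natCast R 2, ← Real.rpow_mul hR0, hσ]
        congr 1
        push_cast
        ring
      rw [this, hx]
      have : 0 < σ := by rw [hσ]; positivity
      gcongr
      linarith
    calc u (x, t) ≤ 1 * Real.exp (ε / 2 * R ^ (p / (p - 1))) := by
          rw [one_mul]
          exact hR₀ R hRR₀ x t hx.le ht.1 (ht.2.trans hT'.le)
      _ ≤ M * Real.exp (ε / 2 * R ^ (p / (p - 1))) * Real.exp (ε / 2 * R ^ (p / (p - 1))) := by
          gcongr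
      _ = M * 1 * Real.exp (ε * 1 * R ^ (p / (p - 1))) := by
          rw [mul_assoc, ← Real.exp_add]
          ring_nf
      _ ≤ _ := by
          simp only [hw]
          have h0 : 0 ≤ K * t := mul_nonneg hK0.le ht.1
          gcongr
          · exact Real.one_le_exp (by positivity)
          · exact Real.one_le_exp h0
  rcases le_or_exists_touching (hu.mono hQ) hwcont.continuousOn
    (fun q _ => hM.trans_le (hMw q)) (fun x _ => (hbot x).trans (hMw _)) htop hlat with h | h
  · simpa [hw] using h x₀ t₀ ⟨ht₀.1.le, ht₀'.le⟩ hRx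
  · exfalso
    obtain ⟨x, t, ht, θ, hθ, -, heq, hle⟩ := h
    have hθ0 : 0 < θ := by linarith
    have htT : t ∈ Ioo 0 T := ⟨ht.1, ht.2.trans hT'⟩
    have hmax := hsub _ (htest θ) (x, t) ⟨mem_univ _, htT⟩ <| by
      filter_upwards [nhdsWithin_le_nhds hle] with q hq
      linarith
    set A := θ * (M * Real.exp (ε * Real.exp (N * (t - t₀)))) with hA
    set b := ε * Real.exp (K * t) with hb
    set P := (1 + ‖x‖ ^ 2) ^ σ with hP
    have hP0 : 0 < P := by positivity
    set G := A * Real.exp (b * P) with hG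
    have hG0 : 0 < G := by positivity
    have hb2 : b ≤ 1 / 2 := hεK.trans' (by rw [hb]; gcongr; exact htT.2.le)
    have hlap : pSpaceLap n p (fun q => θ * w q) (x, t) ≤ K * b * P * G ^ (p - 1) := by
      have := pLap_exp_barrier_le hn hp hσ (show 0 < A by positivity)
        (show 0 < b by positivity) hb2 x
      rw [← hK] at this
      simpa only [pSpaceLap, hw, ← mul_assoc, hA, hG, hb, hP] using this
    have htime : timeDeriv n (fun q => θ * w q) (x, t) =
        G * (ε * N * Real.exp (N * (t - t₀)) + K * b * P) := by
      have hd : ∀ c d : ℝ, HasDerivAt (fun t => ε * Real.exp (c * (t - d)))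
          (ε * c * Real.exp (c * (t - d))) t := fun c d =>
        (((((hasDerivAt_id t).sub_const d).const_mul c).exp).const_mul ε).congr_deriv (by simp; ring)
      have h2 := (hd K 0).mul_const P
      simp only [sub_zero] at h2
      refine (((((hd N t₀).exp).const_mul M).mul h2.exp).const_mul θ).deriv.trans ?_
      simp only [hG, hA, hb]
      ring
    have hu_eq : u (x, t) = G := by rw [heq]; simp only [hw, hG, hA, hb, hP]; ring
    have e : G ^ (p - 1) = G ^ (p - 2) * G := by
      rw [← Real.rpow_add_one hG0.ne']
      congr 1
      ring
    rw [hu_eq, htime] at hmax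
    have h1 : 0 < G ^ (p - 2) * G * (ε * N * Real.exp (N * (t - t₀))) := by positivity
    have h2 : 0 < G ^ (p - 2) * G * (K * b * P) := by positivity
    rw [e] at hlap
    nlinarith

theorem TrudSub.le_of_initial_le (hn : 2 ≤ n) (hp : 2 ≤ p)
    (hu : ContinuousOn u ((univ ×ˢ {(0 : ℝ)}) ∪ (univ ×ˢ Ioo (0 : ℝ) T)))
    (hsub : TrudSub n p (univ ×ˢ Ioo (0 : ℝ) T) u)
    {M : ℝ} (hM : 0 < M) (hbot : ∀ x, u (x, 0) ≤ M)
    (hgrowth : ∀ ε > (0 : ℝ), ∃ R₀ : ℝ, ∀ R ≥ R₀, ∀ x : EuclideanSpace ℝ (Fin n), ∀ t : ℝ,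
      ‖x‖ ≤ R → 0 ≤ t → t ≤ T → u (x, t) ≤ Real.exp (ε * R ^ (p / (p - 1))))
    (x : EuclideanSpace ℝ (Fin n)) {t : ℝ} (ht : t ∈ Ioo 0 T) : u (x, t) ≤ M := by
  set K : ℝ := 2 * (n + p - 2) + 2 * (p - 1) with hK
  set σ : ℝ := p / (p - 1) / 2 with hσ
  have hlim : Tendsto (fun ε : ℝ => M * Real.exp ε *
      Real.exp (ε * Real.exp (K * t) * (1 + ‖x‖ ^ 2) ^ σ)) (𝓝[>] 0) (𝓝 M) := by
    have : Continuous fun ε : ℝ => M * Real.exp ε *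
      Real.exp (ε * Real.exp (K * t) * (1 + ‖x‖ ^ 2) ^ σ) := by fun_prop
    simpa using (this.tendsto 0).mono_left nhdsWithin_le_nhds
  have hsmall : ∀ᶠ ε in 𝓝[>] (0 : ℝ), ε * Real.exp (K * T) ≤ 1 / 2 := by
    have : Continuous fun ε : ℝ => ε * Real.exp (K * T) := by fun_prop
    exact nhdsWithin_le_nhds ((this.tendsto 0).eventually_le_const (by simp))
  refine ge_of_tendsto hlim ?_
  filter_upwards [hsmall, self_mem_nhdsWithin] with ε h1 h2
  exact TrudSub.le_barrier hn hp hu hsub hM hbot hgrowth hσ hK h2 h1 x ht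

theorem TrudSuper.barrier_le (hp : 2 ≤ p)
    (hu : ContinuousOn u ((univ ×ˢ {(0 : ℝ)}) ∪ (univ ×ˢ Ioo (0 : ℝ) T)))
    (hupos : ∀ q ∈ (univ ×ˢ {(0 : ℝ)}) ∪
      ((univ : Set (EuclideanSpace ℝ (Fin n))) ×ˢ Ioo (0 : ℝ) T), 0 < u q)
    (hsuper : TrudSuper n p (univ ×ˢ Ioo (0 : ℝ) T) u)
    {m : ℝ} (hm : 0 < m) (hbot : ∀ x, m ≤ u (x, 0))
    {K R : ℝ} (hK : 0 < K) (hR : 1 ≤ R)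
    (hbump : ∀ c > 0, ∀ x : EuclideanSpace ℝ (Fin n), ‖x‖ < R →
      -(K / R ^ 2 * (c * (1 - ‖x‖ ^ 2 / R ^ 2) ^ 2) ^ (p - 1)) ≤
        pLap n p (fun x => c * (1 - ‖x‖ ^ 2 / R ^ 2) ^ 2) x)
    {x₀ : EuclideanSpace ℝ (Fin n)} (hx₀ : ‖x₀‖ ≤ R) {t₀ : ℝ} (ht₀ : t₀ ∈ Ioo 0 T) :
    m * Real.exp (-(K / R ^ 2 * t₀) - 1 / R ^ 2) * (1 - ‖x₀‖ ^ 2 / R ^ 2) ^ 2 ≤ u (x₀, t₀) := by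
  have hR0 : 0 < R := by linarith
  have hp1 : 0 < p - 1 := by linarith
  obtain ⟨T', ht₀', hT'⟩ := exists_between ht₀.2
  have hT'0 : 0 < T' := ht₀.1.trans ht₀'
  have hQ := closedBall_prod_Icc_subset (E := EuclideanSpace ℝ (Fin n)) (R := R) hT'
  obtain ⟨q₁, hq₁, hmin⟩ := ((isCompact_closedBall (0 : EuclideanSpace ℝ (Fin n)) R).prod
    (isCompact_Icc (a := 0) (b := T'))).exists_isMinOn
      ⟨(x₀, t₀), by simpa using hx₀, ht₀.1.le, ht₀'.le⟩ (hu.mono hQ)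
  have hu₁ := hupos _ (hQ hq₁)
  obtain ⟨N, hN, hNC⟩ := exists_le_mul_exp (show 0 < 1 / R ^ 2 by positivity)
    (sub_pos.2 ht₀') (m / u q₁)
  set w : EuclideanSpace ℝ (Fin n) × ℝ → ℝ := fun q =>
    m * Real.exp (-(K / R ^ 2 * q.2) - 1 / R ^ 2 * Real.exp (N * (q.2 - t₀))) *
      (1 - ‖q.1‖ ^ 2 / R ^ 2) ^ 2 with hw
  have hwcont : Continuous w := by fun_prop
  have hBz : ∀ x : EuclideanSpace ℝ (Fin n), ‖x‖ ≤ R → (1 - ‖x‖ ^ 2 / R ^ 2) ^ 2 ≤ 1 := fun x hx => by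
    have h1 : ‖x‖ ^ 2 / R ^ 2 ≤ 1 := (div_le_one (by positivity)).2 (by gcongr)
    have h2 : 0 ≤ ‖x‖ ^ 2 / R ^ 2 := by positivity
    exact pow_le_one₀ (by linarith) (by linarith)
  have htest : ∀ θ, ParaTestFn n fun q => θ * w q := fun θ => by
    have hns : ContDiff ℝ 2 fun x : EuclideanSpace ℝ (Fin n) => ‖x‖ ^ 2 := contDiff_norm_sq ℝ
    exact ⟨fun t => by simp only [hw]; fun_prop, fun x => by simp only [hw]; fun_prop⟩
  have hbot' : ∀ x, ‖x‖ ≤ R → w (x, 0) ≤ u (x, 0) := fun x hx => by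
    refine le_trans ?_ (hbot x)
    calc w (x, 0) ≤ m * 1 * 1 := by
          simp only [hw]
          gcongr
          · rw [Real.exp_le_one_iff, mul_zero, neg_zero, zero_sub, neg_nonpos]
            positivity
          · exact hBz x hx
      _ = m := by ring
  have htop : ∀ x, ‖x‖ ≤ R → w (x, T') ≤ u (x, T') := fun x hx => by
    have h1 : u q₁ ≤ u (x, T') := hmin ⟨by simpa using hx, hT'0.le, le_rfl⟩
    refine le_trans ?_ h1
    set D := 1 / R ^ 2 * Real.exp (N * (T' - t₀)) with hD
    have h2 : m ≤ u q₁ * D := (div_le_iff₀' hu₁).1 hNC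
    have h3 : D ≤ Real.exp D := by linarith [Real.add_one_le_exp D]
    calc w (x, T') ≤ m * Real.exp (-D) * 1 := by
          simp only [hw]
          gcongr
          · rw [← hD]
            have : 0 ≤ K / R ^ 2 * T' := by positivity
            linarith
          · exact hBz x hx
      _ ≤ u q₁ * Real.exp D * Real.exp (-D) := by
          rw [mul_one]
          gcongr
          exact h2.trans (by gcongr)
      _ = u q₁ := by rw [mul_assoc, ← Real.exp_add]; simp
  have hlat : ∀ x, ∀ t ∈ Icc 0 T', ‖x‖ = R → w (x, t) ≤ u (x, t) := fun x t ht hx => by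
    have : w (x, t) = 0 := by
      simp only [hw, hx]
      rw [div_self (by positivity)]
      simp
    rw [this]
    exact (hupos _ (hQ ⟨by simpa using hx.le, ht⟩)).le
  rcases le_or_exists_touching hwcont.continuousOn (hu.mono hQ)
    (fun q hq => hupos _ (hQ hq)) hbot' htop hlat with h | h
  · simpa [hw] using h x₀ t₀ ⟨ht₀.1.le, ht₀'.le⟩ hx₀
  · exfalso
    obtain ⟨x, t, ht, θ, hθ, hxR, heq, hle⟩ := h
    have hθ0 : 0 < θ := by linarith
    have htT : t ∈ Ioo 0 T := ⟨ht.1, ht.2.trans hT'⟩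
    have hu_eq' : u (x, t) = θ⁻¹ * w (x, t) := by rw [heq]; field_simp
    have hmin' := hsuper _ (htest θ⁻¹) (x, t) ⟨mem_univ _, htT⟩ <| by
      filter_upwards [nhdsWithin_le_nhds hle] with q hq
      have : θ⁻¹ * w q ≤ u q := by rwa [inv_mul_le_iff₀ hθ0]
      linarith
    set c := θ⁻¹ * (m * Real.exp (-(K / R ^ 2 * t) - 1 / R ^ 2 * Real.exp (N * (t - t₀)))) with hc
    have hc0 : 0 < c := by positivity
    set G := c * (1 - ‖x‖ ^ 2 / R ^ 2) ^ 2 with hG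
    have hu_eq : u (x, t) = G := by rw [hu_eq']; simp only [hw, hG, hc]; ring
    have hG0 : 0 < G := hu_eq ▸ hupos _ (Or.inr ⟨mem_univ _, htT⟩)
    have hlap : -(K / R ^ 2 * G ^ (p - 1)) ≤ pSpaceLap n p (fun q => θ⁻¹ * w q) (x, t) := by
      have := hbump c hc0 x hxR
      simpa only [pSpaceLap, hw, ← mul_assoc, hc, hG] using this
    have htime : timeDeriv n (fun q => θ⁻¹ * w q) (x, t) =
        -(G * (K / R ^ 2 + 1 / R ^ 2 * N * Real.exp (N * (t - t₀)))) := by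
      have h1 : HasDerivAt (fun t => 1 / R ^ 2 * Real.exp (N * (t - t₀)))
          (1 / R ^ 2 * N * Real.exp (N * (t - t₀))) t :=
        (((((hasDerivAt_id t).sub_const t₀).const_mul N).exp).const_mul _).congr_deriv
          (by simp; ring)
      have h2 : HasDerivAt (fun t => -(K / R ^ 2 * t)) (-(K / R ^ 2 * 1)) t :=
        ((hasDerivAt_id t).const_mul _).neg
      have h3 : HasDerivAt
          (fun t => -(K / R ^ 2 * t) - 1 / R ^ 2 * Real.exp (N * (t - t₀))) _ t := h2.sub h1
      refine (((h3.exp.const_mul m).mul_const ((1 - ‖x‖ ^ 2 / R ^ 2) ^ 2)).const_mul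
        θ⁻¹).deriv.trans ?_
      simp only [hG, hc]
      ring
    have e : G ^ (p - 1) = G ^ (p - 2) * G := by
      rw [← Real.rpow_add_one hG0.ne']
      congr 1
      ring
    rw [hu_eq, htime] at hmin'
    have h1 : 0 < (p - 1) * (G ^ (p - 2) * G * (1 / R ^ 2 * N * Real.exp (N * (t - t₀)))) := by
      positivity
    have h2 : 0 ≤ (p - 2) * (G ^ (p - 2) * G * (K / R ^ 2)) :=
      mul_nonneg (by linarith) (by positivity)
    rw [e] at hlap
    nlinarith

theorem TrudSuper.le_of_le_initial (hn : 2 ≤ n) (hp : 2 ≤ p)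
    (hu : ContinuousOn u ((univ ×ˢ {(0 : ℝ)}) ∪ (univ ×ˢ Ioo (0 : ℝ) T)))
    (hupos : ∀ q ∈ (univ ×ˢ {(0 : ℝ)}) ∪
      ((univ : Set (EuclideanSpace ℝ (Fin n))) ×ˢ Ioo (0 : ℝ) T), 0 < u q)
    (hsuper : TrudSuper n p (univ ×ˢ Ioo (0 : ℝ) T) u)
    {m : ℝ} (hm : 0 < m) (hbot : ∀ x, m ≤ u (x, 0))
    (x : EuclideanSpace ℝ (Fin n)) {t : ℝ} (ht : t ∈ Ioo 0 T) : m ≤ u (x, t) := by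
  obtain ⟨K, hK, hbump⟩ := exists_le_pLap_bump n hp hn
  have hdiv : ∀ a : ℝ, Tendsto (fun R : ℝ => a / R ^ 2) atTop (𝓝 0) := fun a =>
    tendsto_const_nhds.div_atTop (tendsto_pow_atTop two_ne_zero)
  have hlim : Tendsto (fun R : ℝ => m * Real.exp (-(K / R ^ 2 * t) - 1 / R ^ 2) *
      (1 - ‖x‖ ^ 2 / R ^ 2) ^ 2) atTop (𝓝 m) := by
    have h1 := ((Real.continuous_exp.tendsto _).comp
      ((((hdiv K).mul_const t).neg).sub (hdiv 1))).const_mul m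
    simpa using h1.mul (((hdiv (‖x‖ ^ 2)).const_sub 1).pow 2)
  refine le_of_tendsto hlim ?_
  filter_upwards [eventually_ge_atTop 1, eventually_ge_atTop ‖x‖] with R h1 h2
  exact TrudSuper.barrier_le hp hu hupos hsuper hm hbot hK h1 (hbump R h1) h2 ht

end

/-- Theorem 1.7 for `2 ≤ p < ∞`: a Phragmén–Lindelöf type result for Trudinger's equation in
`ℝⁿ × (0,T)` under the growth condition `u ≤ exp(o(R^{p/(p−1)}))`. -/
theorem stmt3 (n : ℕ) (hn : 2 ≤ n) (p : ℝ) (hp : 2 ≤ p) (T : ℝ) (hT : 0 < T)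
    (f : EuclideanSpace ℝ (Fin n) → ℝ) (hf : Continuous f)
    (hfi : 0 < sInf (Set.range f)) (hfs : BddAbove (Set.range f))
    (u : EuclideanSpace ℝ (Fin n) × ℝ → ℝ)
    (hu : ContinuousOn u
      ((Set.univ ×ˢ {(0 : ℝ)}) ∪ (Set.univ ×ˢ Set.Ioo (0 : ℝ) T)))
    (hupos : ∀ q ∈ (Set.univ ×ˢ {(0 : ℝ)}) ∪
      ((Set.univ : Set (EuclideanSpace ℝ (Fin n))) ×ˢ Set.Ioo (0 : ℝ) T), 0 < u q)
    (hsub : TrudSub n p (Set.univ ×ˢ Set.Ioo (0 : ℝ) T) u)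
    (hsuper : TrudSuper n p (Set.univ ×ˢ Set.Ioo (0 : ℝ) T) u)
    (hic : ∀ x, u (x, 0) = f x)
    (hgrowth : ∀ ε > (0 : ℝ), ∃ R₀ : ℝ, ∀ R ≥ R₀, ∀ x : EuclideanSpace ℝ (Fin n), ∀ t : ℝ,
      ‖x‖ ≤ R → 0 ≤ t → t ≤ T → u (x, t) ≤ Real.exp (ε * R ^ (p / (p - 1)))) :
    ∀ x : EuclideanSpace ℝ (Fin n), ∀ t ∈ Set.Ioo (0 : ℝ) T,
      sInf (Set.range f) ≤ u (x, t) ∧ u (x, t) ≤ sSup (Set.range f) := by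
  intro x t ht
  have hbdd : BddBelow (Set.range f) := ⟨0, by
    rintro _ ⟨y, rfl⟩
    exact hic y ▸ (hupos (y, 0) (Or.inl ⟨mem_univ _, rfl⟩)).le⟩
  have hle : ∀ y, sInf (Set.range f) ≤ f y := fun y => csInf_le hbdd ⟨y, rfl⟩
  have hge : ∀ y, f y ≤ sSup (Set.range f) := fun y => le_csSup hfs ⟨y, rfl⟩
  exact ⟨TrudSuper.le_of_le_initial hn hp hu hupos hsuper hfi (fun y => hic y ▸ hle y) x ht,
    TrudSub.le_of_initial_le hn hp hu hsub (hfi.trans_le ((hle 0).trans (hge 0)))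
      (fun y => hic y ▸ hge y) hgrowth x ht⟩
end

section
/- Let n ≥ 2, T > 0, H = ℝⁿ and H_T = ℝⁿ×(0,T). Let f ∈ C(H) with 0 < inf_H f ≤ sup_H f < ∞. Suppose u ∈ C((H×{0}) ∪ H_T), u > 0, is a viscosity solution of Γ_∞ u = 0 in H_T with u(x,0) = f(x), and suppose that as R → ∞, sup_{0≤|x|≤R, 0≤t≤T} u(x,t) ≤ exp(o(R^{4/3})). Then inf_H f ≤ u(x,t) ≤ sup_H f for all (x,t) ∈ H_T. -/
open Set Filter
open scoped Classical

/-- The infinity-Laplacian of a radial function `x ↦ G (‖x‖ ^ 2)`. -/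
lemma infLap_radial (n : ℕ) {s : Set ℝ} (hs0 : ∀ r : ℝ, 0 ≤ r → r ∈ s)
    {G G₁ G₂ : ℝ → ℝ} (h₁ : ∀ r ∈ s, HasDerivAt G (G₁ r) r)
    (h₂ : ∀ r ∈ s, HasDerivAt G₁ (G₂ r) r) (x : EuclideanSpace ℝ (Fin n)) :
    infLap n (fun x => G (‖x‖ ^ 2)) x =
      8 * G₁ (‖x‖ ^ 2) ^ 3 * ‖x‖ ^ 2 + 16 * G₁ (‖x‖ ^ 2) ^ 2 * G₂ (‖x‖ ^ 2) * (‖x‖ ^ 2) ^ 2 := by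
  have hsq : ∀ y : EuclideanSpace ℝ (Fin n),
      HasFDerivAt (fun y : EuclideanSpace ℝ (Fin n) => ‖y‖ ^ 2) (2 • innerSL ℝ y) y :=
    fun y => (hasStrictFDerivAt_norm_sq y).hasFDerivAt
  have hmem : ∀ y : EuclideanSpace ℝ (Fin n), ‖y‖ ^ 2 ∈ s := fun y => hs0 _ (by positivity)
  have hG : ∀ y : EuclideanSpace ℝ (Fin n), HasFDerivAt
      (fun y : EuclideanSpace ℝ (Fin n) => G (‖y‖ ^ 2)) (G₁ (‖y‖ ^ 2) • (2 • innerSL ℝ y)) y :=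
    fun y => (h₁ _ (hmem y)).comp_hasFDerivAt y (hsq y)
  have hG₁ : HasFDerivAt
      (fun y : EuclideanSpace ℝ (Fin n) => G₁ (‖y‖ ^ 2)) (G₂ (‖x‖ ^ 2) • (2 • innerSL ℝ x)) x :=
    (h₂ _ (hmem x)).comp_hasFDerivAt x (hsq x)
  have hgrad : gradient (fun y : EuclideanSpace ℝ (Fin n) => G (‖y‖ ^ 2)) x =
      (2 * G₁ (‖x‖ ^ 2)) • x := by
    apply HasGradientAt.gradient
    rw [hasGradientAt_iff_hasFDerivAt]
    refine (hG x).congr_fderiv ?_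
    ext v
    simp only [map_smul, smul_apply, InnerProductSpace.toDual_apply_apply,
      innerSL_apply_apply, smul_eq_mul, nsmul_eq_mul, Nat.cast_ofNat]
    ring
  have hfd : fderiv ℝ (fun y : EuclideanSpace ℝ (Fin n) => G (‖y‖ ^ 2)) =
      fun y => G₁ (‖y‖ ^ 2) • (2 • innerSL ℝ y) := funext fun y => (hG y).fderiv
  have hlin : HasFDerivAt (fun y : EuclideanSpace ℝ (Fin n) => (2 • innerSL ℝ y))
      (2 • (innerSL ℝ : EuclideanSpace ℝ (Fin n) →L[ℝ] _)) x :=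
    (2 • (innerSL ℝ : EuclideanSpace ℝ (Fin n) →L[ℝ] _)).hasFDerivAt
  have h2 := hG₁.smul hlin
  rw [infLap, iteratedFDeriv_two_apply, hfd]
  have h3 : fderiv ℝ (fun y : EuclideanSpace ℝ (Fin n) => G₁ (‖y‖ ^ 2) • (2 • innerSL ℝ y)) x = _ :=
    h2.fderiv
  rw [h3, hgrad]
  have h4 : innerSL ℝ x x = ‖x‖ ^ 2 := by
    rw [innerSL_apply_apply, real_inner_self_eq_norm_sq]
  simp only [Matrix.cons_val_zero, Matrix.cons_val_one, map_smul, h4, smul_eq_mul, nsmul_eq_mul,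
    Nat.cast_ofNat, smul_apply, add_apply,
    ContinuousLinearMap.smulRight_apply]
  ring

lemma radial_estimate {δ a r b d h : ℝ} (hδ : 0 < δ) (hr : 0 ≤ r) (hb : 0 < b) (hd : d ≤ 0)
    (hh : 1 ≤ h) (h3 : b ^ 3 * (1 + r) = 8 / 27 * a ^ 3)
    (h4 : b ^ 4 * (1 + r) ^ 2 = 16 / 81 * a ^ 4 * h)
    (ha3 : a ^ 3 ≤ δ * (1 / 4)) (ha4 : a ^ 4 ≤ δ * (1 / 8)) :
    8 * b ^ 3 * r + 16 * b ^ 2 * (b ^ 2 + d) * r ^ 2 < 3 * (δ * h) := by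
  have e1 : b ^ 3 * r ≤ b ^ 3 * (1 + r) := by gcongr; linarith
  have e2 : b ^ 2 * (b ^ 2 + d) * r ^ 2 ≤ b ^ 4 * (1 + r) ^ 2 := by
    calc b ^ 2 * (b ^ 2 + d) * r ^ 2 ≤ b ^ 2 * (b ^ 2) * (1 + r) ^ 2 := by
          have : b ^ 2 * (b ^ 2 + d) * r ^ 2 ≤ b ^ 2 * (b ^ 2) * r ^ 2 := by
            gcongr; linarith
          refine this.trans ?_
          gcongr; linarith
      _ = b ^ 4 * (1 + r) ^ 2 := by ring
  have e3 : a ^ 4 * h ≤ δ * (1 / 8) * h := by gcongr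
  have e4 : δ ≤ δ * h := le_mul_of_one_le_right hδ.le hh
  have e5 : 0 < δ * h := by positivity
  linarith

/-- A strict supersolution with growth `exp (δ * ‖x‖ ^ (4 / 3))`. -/
noncomputable def upperBarrier (n : ℕ) (C δ ε t₀ : ℝ) (N : ℕ)
    (q : EuclideanSpace ℝ (Fin n) × ℝ) : ℝ :=
  C * Real.exp (δ * (1 + q.2) * (1 + ‖q.1‖ ^ 2) ^ ((2 : ℝ) / 3) + ε * (q.2 / t₀) ^ N)

lemma paraTestFn_upperBarrier (n : ℕ) (C δ ε t₀ : ℝ) (N : ℕ) :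
    ParaTestFn n (upperBarrier n C δ ε t₀ N) := by
  unfold upperBarrier
  refine ⟨fun t => ?_, fun x => ?_⟩
  · have : ContDiff ℝ 2 (fun x : EuclideanSpace ℝ (Fin n) => (1 + ‖x‖ ^ 2) ^ ((2 : ℝ) / 3)) :=
      (contDiff_const.add (contDiff_norm_sq ℝ)).rpow_const_of_ne fun x => by positivity
    dsimp only
    fun_prop
  · dsimp only
    fun_prop

lemma infLap_upperBarrier_lt (n : ℕ) {C δ ε t₀ T : ℝ} (N : ℕ) (hC : 0 < C) (hδ : 0 < δ)
    (hε : 0 < ε) (ht₀ : 0 < t₀) (hδT : δ * (1 + T) ^ 2 ≤ 1 / 2)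
    (x : EuclideanSpace ℝ (Fin n)) {t : ℝ} (ht : 0 < t) (htT : t < T) :
    infLap n (fun x => upperBarrier n C δ ε t₀ N (x, t)) x -
      3 * upperBarrier n C δ ε t₀ N (x, t) ^ 2 *
        timeDeriv n (upperBarrier n C δ ε t₀ N) (x, t) < 0 := by
  set a : ℝ := δ * (1 + t) with ha
  set c : ℝ := ε * (t / t₀) ^ N with hc
  have ha0 : 0 < a := by positivity
  set G : ℝ → ℝ := fun r => C * Real.exp (a * (1 + r) ^ ((2 : ℝ) / 3) + c) with hG
  set b : ℝ → ℝ := fun r => a * (2 / 3 * (1 + r) ^ (-(1 : ℝ) / 3)) with hb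
  set d : ℝ → ℝ := fun r => a * (2 / 3 * (-(1 : ℝ) / 3 * (1 + r) ^ (-(4 : ℝ) / 3))) with hd
  have hadd : ∀ r : ℝ, HasDerivAt (fun r : ℝ => 1 + r) 1 r :=
    fun r => by simpa using (hasDerivAt_id r).const_add 1
  have hGd : ∀ r ∈ Ioi (-1 : ℝ), HasDerivAt G (G r * b r) r := by
    intro r hr
    have hr' : 1 + r ≠ 0 := by have := mem_Ioi.1 hr; linarith
    have h := ((((hadd r).rpow_const (p := (2 : ℝ) / 3) (Or.inl hr')).const_mul a).add_const c
      ).exp.const_mul C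
    refine h.congr_deriv ?_
    simp only [hG, hb]
    rw [show (2 : ℝ) / 3 - 1 = -1 / 3 by norm_num]
    ring
  have hbd : ∀ r ∈ Ioi (-1 : ℝ), HasDerivAt b (d r) r := by
    intro r hr
    have hr' : 1 + r ≠ 0 := by have := mem_Ioi.1 hr; linarith
    have h := (((hadd r).rpow_const (p := -(1 : ℝ) / 3) (Or.inl hr')).const_mul
      (2 / 3 : ℝ)).const_mul a
    refine h.congr_deriv ?_
    simp only [hd]
    rw [show -(1 : ℝ) / 3 - 1 = -4 / 3 by norm_num]
    ring
  have hlap := infLap_radial n (fun r hr => mem_Ioi.2 (by linarith)) hGd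
    (fun r hr => (hGd r hr).mul (hbd r hr)) x
  set r : ℝ := ‖x‖ ^ 2 with hr
  have hr0 : 0 ≤ r := by positivity
  set h : ℝ := (1 + r) ^ ((2 : ℝ) / 3) with hh
  have htime : timeDeriv n (upperBarrier n C δ ε t₀ N) (x, t) =
      G r * (δ * h + ε * (N * (t / t₀) ^ (N - 1) * (1 / t₀))) := by
    have h1 : HasDerivAt (fun t : ℝ => δ * (1 + t) * h + ε * (t / t₀) ^ N)
        (δ * h + ε * (N * (t / t₀) ^ (N - 1) * (1 / t₀))) t := by
      have e1 := (((hadd t).const_mul δ).mul_const h)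
      have e2 := ((((hasDerivAt_id t).div_const t₀).pow N).const_mul ε)
      refine (e1.add e2).congr_deriv ?_
      simp
    have h2 := (h1.exp.const_mul C).deriv
    unfold timeDeriv upperBarrier
    dsimp only
    rw [h2]
    simp only [hG]
    ring
  have hval : upperBarrier n C δ ε t₀ N (x, t) = G r := rfl
  have hfun : (fun x => upperBarrier n C δ ε t₀ N (x, t)) = fun x => G (‖x‖ ^ 2) := rfl
  rw [htime, hfun, hlap, hval]
  have hGpos : 0 < G r := by positivity
  set q : ℝ := (1 + r) ^ (-(1 : ℝ) / 3) with hq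
  have hp0 : 0 < 1 + r := by positivity
  have hq0 : 0 < q := by positivity
  have hbq : b r = 2 / 3 * a * q := by simp only [hb, hq]; ring
  have hq3 : q ^ 3 * (1 + r) = 1 := by
    rw [hq, ← Real.rpow_natCast, ← Real.rpow_mul hp0.le]
    norm_num [Real.rpow_neg_one]
    field_simp
  have hhq : h = (1 + r) * q := by
    rw [hh, hq, ← Real.rpow_one_add' hp0.le (by norm_num)]
    norm_num
  have hd0 : d r ≤ 0 := by
    have : 0 ≤ a * (1 + r) ^ (-(4 : ℝ) / 3) := by positivity
    simp only [hd]; linarith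
  have hh1 : 1 ≤ h := Real.one_le_rpow (by linarith) (by norm_num)
  have hb0 : 0 < b r := by rw [hbq]; positivity
  have hN : 0 ≤ ε * (N * (t / t₀) ^ (N - 1) * (1 / t₀)) := by positivity
  have h3 : b r ^ 3 * (1 + r) = 8 / 27 * a ^ 3 := by
    rw [hbq]; linear_combination (8 / 27 * a ^ 3) * hq3
  have h4 : b r ^ 4 * (1 + r) ^ 2 = 16 / 81 * a ^ 4 * h := by
    rw [hbq, hhq]; linear_combination (16 / 81 * a ^ 4 * q * (1 + r)) * hq3
  have haT : a ^ 3 ≤ δ * (1 / 4) := by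
    have e1 : a ≤ δ * (1 + T) := by rw [ha]; gcongr
    have e2 : (δ * (1 + T) ^ 2) ^ 2 ≤ (1 / 2) ^ 2 := by gcongr
    have e3 : a ^ 3 ≤ (δ * (1 + T)) ^ 3 := by gcongr
    have e4 : (1 + T) ^ 3 ≤ (1 + T) ^ 4 := pow_le_pow_right₀ (by linarith) (by norm_num)
    have e5 : δ ^ 3 * (1 + T) ^ 3 ≤ δ ^ 3 * (1 + T) ^ 4 := by gcongr
    have e7 : δ ^ 3 * (1 + T) ^ 4 = δ * (δ * (1 + T) ^ 2) ^ 2 := by ring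
    have e8 : δ * (δ * (1 + T) ^ 2) ^ 2 ≤ δ * (1 / 2) ^ 2 := by gcongr
    have e9 : (δ * (1 + T)) ^ 3 = δ ^ 3 * (1 + T) ^ 3 := by ring
    linarith
  have ha1 : a ≤ 1 / 2 := by
    have e1 : a ≤ δ * (1 + T) := by rw [ha]; gcongr
    have e4 : δ * (1 + T) ≤ δ * (1 + T) ^ 2 := by gcongr; nlinarith
    linarith
  have ha4 : a ^ 4 ≤ δ * (1 / 8) := by
    have : a ^ 4 = a ^ 3 * a := by ring
    have e : a ^ 3 * a ≤ (δ * (1 / 4)) * (1 / 2) := by gcongr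
    linarith
  have key : 8 * b r ^ 3 * r + 16 * b r ^ 2 * (b r ^ 2 + d r) * r ^ 2 < 3 * (δ * h) :=
    radial_estimate hδ hr0 hb0 hd0 hh1 h3 h4 haT ha4
  have hG3 : 0 < G r ^ 3 := by positivity
  have h5 := mul_nonneg hG3.le hN
  have h6 := mul_lt_mul_of_pos_left key hG3
  have e : 8 * (G r * b r) ^ 3 * r + 16 * (G r * b r) ^ 2 * (G r * b r * b r + G r * d r) * r ^ 2 -
      3 * G r ^ 2 * (G r * (δ * h + ε * (N * (t / t₀) ^ (N - 1) * (1 / t₀)))) =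
      G r ^ 3 * (8 * b r ^ 3 * r + 16 * b r ^ 2 * (b r ^ 2 + d r) * r ^ 2) -
      G r ^ 3 * (3 * (δ * h)) - 3 * (G r ^ 3 * (ε * (N * (t / t₀) ^ (N - 1) * (1 / t₀)))) := by
    ring
  linarith

/-- A strict subsolution on `Metric.ball 0 R`, vanishing on its boundary. -/
noncomputable def lowerBarrier (n : ℕ) (C R ε t₀ : ℝ) (N : ℕ)
    (q : EuclideanSpace ℝ (Fin n) × ℝ) : ℝ :=
  C * Real.exp (-(100 / R ^ 4 * q.2 + ε * (q.2 / t₀) ^ N)) * (R ^ 2 - ‖q.1‖ ^ 2) ^ 2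

lemma paraTestFn_lowerBarrier (n : ℕ) (C R ε t₀ : ℝ) (N : ℕ) :
    ParaTestFn n (lowerBarrier n C R ε t₀ N) := by
  unfold lowerBarrier
  refine ⟨fun t => ?_, fun x => ?_⟩
  · have : ContDiff ℝ 2 (fun x : EuclideanSpace ℝ (Fin n) => ‖x‖ ^ 2) := contDiff_norm_sq ℝ
    dsimp only
    fun_prop
  · dsimp only
    fun_prop

lemma infLap_lowerBarrier_gt (n : ℕ) {C R ε t₀ : ℝ} (N : ℕ) (hC : 0 < C) (hR : 0 < R)
    (hε : 0 < ε) (ht₀ : 0 < t₀) {x : EuclideanSpace ℝ (Fin n)} (hx : ‖x‖ < R) {t : ℝ}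
    (ht : 0 < t) :
    0 < infLap n (fun x => lowerBarrier n C R ε t₀ N (x, t)) x -
      3 * lowerBarrier n C R ε t₀ N (x, t) ^ 2 *
        timeDeriv n (lowerBarrier n C R ε t₀ N) (x, t) := by
  set A : ℝ := C * Real.exp (-(100 / R ^ 4 * t + ε * (t / t₀) ^ N)) with hA
  have hA0 : 0 < A := by positivity
  set G : ℝ → ℝ := fun r => A * (R ^ 2 - r) ^ 2 with hG
  have hsub : ∀ r : ℝ, HasDerivAt (fun r : ℝ => R ^ 2 - r) (-1) r :=
    fun r => by simpa using (hasDerivAt_id r).const_sub (R ^ 2)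
  have hGd : ∀ r ∈ (univ : Set ℝ), HasDerivAt G (-2 * A * (R ^ 2 - r)) r := by
    intro r _
    refine (((hsub r).pow 2).const_mul A).congr_deriv ?_
    push_cast
    ring
  have hGd' : ∀ r ∈ (univ : Set ℝ),
      HasDerivAt (fun r => -2 * A * (R ^ 2 - r)) (2 * A) r := by
    intro r _
    refine ((hsub r).const_mul (-2 * A)).congr_deriv ?_
    ring
  have hlap := infLap_radial n (fun r hr => mem_univ r) hGd hGd' x
  set r : ℝ := ‖x‖ ^ 2 with hr
  have hr0 : 0 ≤ r := by positivity
  have hrR : r < R ^ 2 := by rw [hr]; gcongr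
  set D : ℝ := ε * (N * (t / t₀) ^ (N - 1) * (1 / t₀)) with hD
  have hD0 : 0 ≤ D := by positivity
  have htime : timeDeriv n (lowerBarrier n C R ε t₀ N) (x, t) =
      -(100 / R ^ 4 + D) * G r := by
    have h1 : HasDerivAt (fun t : ℝ => -(100 / R ^ 4 * t + ε * (t / t₀) ^ N))
        (-(100 / R ^ 4 + D)) t := by
      have e1 := (hasDerivAt_id t).const_mul (100 / R ^ 4)
      have e2 := ((((hasDerivAt_id t).div_const t₀).pow N).const_mul ε)
      refine (e1.add e2).neg.congr_deriv ?_
      simp [hD]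
    have h2 := ((h1.exp.const_mul C).mul_const ((R ^ 2 - ‖x‖ ^ 2) ^ 2)).deriv
    unfold timeDeriv lowerBarrier
    dsimp only
    rw [h2]
    simp only [hG, hA]
    ring
  have hval : lowerBarrier n C R ε t₀ N (x, t) = G r := rfl
  have hfun : (fun x => lowerBarrier n C R ε t₀ N (x, t)) = fun x => G (‖x‖ ^ 2) := rfl
  rw [htime, hfun, hlap, hval]
  simp only [hG]
  obtain ⟨s, hs⟩ : ∃ s, s = R ^ 2 - r := ⟨_, rfl⟩
  obtain ⟨P, hP⟩ : ∃ P, P = R ^ 2 := ⟨_, rfl⟩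
  have hP0 : 0 < P := by rw [hP]; positivity
  have hs0 : 0 < s := by linarith
  have hrs : r = P - s := by linarith
  have hR4 : R ^ 4 = P ^ 2 := by rw [hP]; ring
  rw [← hs, hR4]
  have key : 0 < 64 * (P - s) * (2 * P - 3 * s) + 300 / P ^ 2 * s ^ 4 := by
    by_cases h : 3 * s ≤ 2 * P
    · have : 0 < 300 / P ^ 2 * s ^ 4 := by positivity
      have : 0 ≤ (P - s) * (2 * P - 3 * s) := mul_nonneg (by linarith) (by linarith)
      linarith
    · push Not at h
      have h1 : (2 * P / 3) ^ 4 < s ^ 4 := by gcongr; linarith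
      have h2 : 300 / P ^ 2 * (2 * P / 3) ^ 4 < 300 / P ^ 2 * s ^ 4 := by gcongr
      have h3 : 300 / P ^ 2 * (2 * P / 3) ^ 4 = 300 * 16 / 81 * P ^ 2 := by
        field_simp; norm_num
      nlinarith
  have e : 8 * (-2 * A * s) ^ 3 * r + 16 * (-2 * A * s) ^ 2 * (2 * A) * r ^ 2 -
      3 * (A * s ^ 2) ^ 2 * (-(100 / P ^ 2 + D) * (A * s ^ 2)) =
      A ^ 3 * s ^ 2 * (64 * (P - s) * (2 * P - 3 * s) + 300 / P ^ 2 * s ^ 4) +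
        3 * A ^ 3 * s ^ 6 * D := by
    rw [hrs]; ring
  rw [e]
  have := mul_pos (by positivity : 0 < A ^ 3 * s ^ 2) key
  have : 0 ≤ 3 * A ^ 3 * s ^ 6 * D := by positivity
  linarith

/-- A function on a compact cylinder that is at most `1` on the boundary but exceeds `1` somewhere
has an interior local maximum with value greater than `1`. -/
lemma exists_isLocalMax_cylinder {E : Type*} [NormedAddCommGroup E] [ProperSpace E]
    {F : E × ℝ → ℝ} {R S : ℝ}
    (hF : ContinuousOn F (Metric.closedBall 0 R ×ˢ Icc 0 S))
    (hlat : ∀ x t, ‖x‖ = R → t ∈ Icc 0 S → F (x, t) ≤ 1)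
    (hbot : ∀ x, ‖x‖ ≤ R → F (x, 0) ≤ 1) (htop : ∀ x, ‖x‖ ≤ R → F (x, S) ≤ 1)
    {q₀ : E × ℝ} (hq₀ : q₀ ∈ Metric.closedBall (0 : E) R ×ˢ Icc 0 S) (h₀ : 1 < F q₀) :
    ∃ q : E × ℝ, ‖q.1‖ < R ∧ 0 < q.2 ∧ q.2 < S ∧ 1 < F q ∧ IsLocalMax F q := by
  obtain ⟨⟨x, t⟩, hq, hmax⟩ :=
    ((isCompact_closedBall (0 : E) R).prod isCompact_Icc).exists_isMaxOn ⟨q₀, hq₀⟩ hF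
  have h1 : 1 < F (x, t) := h₀.trans_le (hmax hq₀)
  obtain ⟨hx, ht⟩ := hq
  simp only [mem_closedBall_zero_iff] at hx
  dsimp only at ht
  have hx' : ‖x‖ < R := lt_of_le_of_ne hx fun h => (hlat x t h ht).not_gt h1
  have ht0 : 0 < t := lt_of_le_of_ne ht.1 fun h => by subst h; exact (hbot x hx).not_gt h1
  have htS : t < S := lt_of_le_of_ne ht.2 fun h => by subst h; exact (htop x hx).not_gt h1
  refine ⟨(x, t), hx', ht0, htS, h1, hmax.isLocalMax (prod_mem_nhds ?_ (Icc_mem_nhds ht0 htS))⟩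
  exact Metric.closedBall_mem_nhds_of_mem (by simpa using hx')

lemma upperBarrier_smul (n : ℕ) (c C δ ε t₀ : ℝ) (N : ℕ) (q : EuclideanSpace ℝ (Fin n) × ℝ) :
    upperBarrier n (c * C) δ ε t₀ N q = c * upperBarrier n C δ ε t₀ N q := by
  unfold upperBarrier; ring

lemma upperBarrier_pos (n : ℕ) {C : ℝ} (hC : 0 < C) (δ ε t₀ : ℝ) (N : ℕ)
    (q : EuclideanSpace ℝ (Fin n) × ℝ) : 0 < upperBarrier n C δ ε t₀ N q := by
  unfold upperBarrier; positivity

lemma continuous_upperBarrier (n : ℕ) (C δ ε t₀ : ℝ) (N : ℕ) :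
    Continuous (upperBarrier n C δ ε t₀ N) := by
  unfold upperBarrier
  have : Continuous fun q : EuclideanSpace ℝ (Fin n) × ℝ => (1 + ‖q.1‖ ^ 2) ^ ((2 : ℝ) / 3) :=
    Continuous.rpow_const (by fun_prop) fun q => Or.inr (by norm_num)
  fun_prop

lemma lowerBarrier_smul (n : ℕ) (c C R ε t₀ : ℝ) (N : ℕ) (q : EuclideanSpace ℝ (Fin n) × ℝ) :
    lowerBarrier n (c * C) R ε t₀ N q = c * lowerBarrier n C R ε t₀ N q := by
  unfold lowerBarrier; ring

lemma continuous_lowerBarrier (n : ℕ) (C R ε t₀ : ℝ) (N : ℕ) :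
    Continuous (lowerBarrier n C R ε t₀ N) := by
  unfold lowerBarrier
  fun_prop

/-- For a subsolution `u`, the ratio of `u` to the upper barrier has no interior local maximum. -/
lemma GammaInfSub.not_isLocalMax_div {n : ℕ} {T : ℝ} {u : EuclideanSpace ℝ (Fin n) × ℝ → ℝ}
    (hsub : GammaInfSub n (univ ×ˢ Ioo (0 : ℝ) T) u) {C δ ε t₀ : ℝ} (N : ℕ) (hC : 0 < C)
    (hδ : 0 < δ) (hε : 0 < ε) (ht₀ : 0 < t₀) (hδT : δ * (1 + T) ^ 2 ≤ 1 / 2)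
    {q : EuclideanSpace ℝ (Fin n) × ℝ} (hq : q.2 ∈ Ioo 0 T)
    (hpos : 0 < u q / upperBarrier n C δ ε t₀ N q) :
    ¬ IsLocalMax (fun z => u z / upperBarrier n C δ ε t₀ N z) q := by
  intro hmax
  set c := u q / upperBarrier n C δ ε t₀ N q with hc
  have hB := upperBarrier_pos n hC δ ε t₀ N
  have huq : u q = upperBarrier n (c * C) δ ε t₀ N q := by
    rw [upperBarrier_smul, hc, div_mul_cancel₀ _ (hB q).ne']
  have hloc : IsLocalMax (fun z => u z - upperBarrier n (c * C) δ ε t₀ N z) q := by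
    filter_upwards [hmax] with z hz
    rw [← huq, sub_self, upperBarrier_smul, sub_nonpos]
    exact (div_le_iff₀ (hB z)).1 hz
  have h := hsub _ (paraTestFn_upperBarrier n (c * C) δ ε t₀ N) q ⟨mem_univ _, hq⟩ (hloc.on _)
  have h' := infLap_upperBarrier_lt n N (mul_pos hpos hC) hδ hε ht₀ hδT q.1 hq.1 hq.2
  rw [huq] at h
  exact absurd h (not_le.2 h')

/-- For a positive supersolution `u`, the ratio of the lower barrier to `u` has no positive local
maximum inside the support of the barrier. -/
lemma GammaInfSuper.not_isLocalMax_div {n : ℕ} {T : ℝ} {u : EuclideanSpace ℝ (Fin n) × ℝ → ℝ}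
    (hsuper : GammaInfSuper n (univ ×ˢ Ioo (0 : ℝ) T) u)
    (hupos : ∀ x, ∀ t ∈ Ioo (0 : ℝ) T, 0 < u (x, t)) {C R ε t₀ : ℝ} (N : ℕ) (hC : 0 < C)
    (hR : 0 < R) (hε : 0 < ε) (ht₀ : 0 < t₀)
    {q : EuclideanSpace ℝ (Fin n) × ℝ} (hqR : ‖q.1‖ < R) (hq : q.2 ∈ Ioo 0 T)
    (hpos : 0 < lowerBarrier n C R ε t₀ N q / u q) :
    ¬ IsLocalMax (fun z => lowerBarrier n C R ε t₀ N z / u z) q := by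
  intro hmax
  set c := lowerBarrier n C R ε t₀ N q / u q with hc
  have huq' : 0 < u q := hupos q.1 q.2 hq
  have huq : u q = lowerBarrier n (c⁻¹ * C) R ε t₀ N q := by
    rw [lowerBarrier_smul, eq_inv_mul_iff_mul_eq₀ hpos.ne', hc, div_mul_cancel₀ _ huq'.ne']
  have hnhds : ∀ᶠ z : EuclideanSpace ℝ (Fin n) × ℝ in nhds q, z.2 ∈ Ioo 0 T :=
    continuous_snd.continuousAt.eventually_mem (Ioo_mem_nhds hq.1 hq.2)
  have hloc : IsLocalMin (fun z => u z - lowerBarrier n (c⁻¹ * C) R ε t₀ N z) q := by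
    filter_upwards [hmax, hnhds] with z hz hzT
    rw [← huq, sub_self, lowerBarrier_smul, sub_nonneg, inv_mul_le_iff₀ hpos]
    exact (div_le_iff₀ (hupos z.1 z.2 hzT)).1 hz
  have h := hsuper _ (paraTestFn_lowerBarrier n (c⁻¹ * C) R ε t₀ N) q ⟨mem_univ _, hq⟩
    (hloc.on _)
  have h' := infLap_lowerBarrier_gt n N (mul_pos (inv_pos.2 hpos) hC) hR hε ht₀ hqR hq.1
  rw [huq] at h
  exact absurd h (not_le.2 h')

lemma norm_rpow_le {E : Type*} [NormedAddCommGroup E] (x : E) :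
    ‖x‖ ^ ((4 : ℝ) / 3) ≤ (1 + ‖x‖ ^ 2) ^ ((2 : ℝ) / 3) := by
  have h : ‖x‖ ^ ((4 : ℝ) / 3) = (‖x‖ ^ 2) ^ ((2 : ℝ) / 3) := by
    rw [← Real.rpow_natCast, ← Real.rpow_mul (norm_nonneg x)]
    norm_num
  rw [h]
  exact Real.rpow_le_rpow (by positivity) (by linarith) (by norm_num)

/-- The growth condition in the form of a global bound. -/
lemma exists_le_exp_of_growth {E : Type*} [NormedAddCommGroup E] {T ε : ℝ} {u : E × ℝ → ℝ}
    (hε : 0 < ε)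
    (hgrowth : ∃ R₀ : ℝ, ∀ R ≥ R₀, ∀ x : E, ∀ t : ℝ,
      ‖x‖ ≤ R → 0 ≤ t → t ≤ T → u (x, t) ≤ Real.exp (ε * R ^ ((4 : ℝ) / 3))) :
    ∃ K : ℝ, ∀ x : E, ∀ t : ℝ, 0 ≤ t → t ≤ T →
      u (x, t) ≤ Real.exp (ε * ((1 + ‖x‖ ^ 2) ^ ((2 : ℝ) / 3) + K)) := by
  obtain ⟨R₀, hR₀⟩ := hgrowth
  refine ⟨(max R₀ 0) ^ ((4 : ℝ) / 3), fun x t h0 hT => ?_⟩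
  refine (hR₀ (max ‖x‖ (max R₀ 0)) (by simp) x t (le_max_left _ _) h0 hT).trans ?_
  have h1 := norm_rpow_le x
  have h2 : 0 ≤ ‖x‖ ^ ((4 : ℝ) / 3) := by positivity
  have h3 : 0 ≤ (max R₀ 0) ^ ((4 : ℝ) / 3) := Real.rpow_nonneg (le_max_right _ _) _
  gcongr
  rcases max_cases ‖x‖ (max R₀ 0) with h | h <;> rw [h.1] <;> linarith

lemma exists_le_mul_pow {a ε : ℝ} (ha : 1 < a) (hε : 0 < ε) (b : ℝ) :
    ∃ N : ℕ, b ≤ ε * a ^ N := by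
  obtain ⟨N, hN⟩ := pow_unbounded_of_one_lt (b / ε) ha
  exact ⟨N, by rw [div_lt_iff₀' hε] at hN; exact hN.le⟩

/-- Subsolutions of small growth lie below the upper barrier. -/
lemma GammaInfSub.le_mul_exp {n : ℕ} {T : ℝ} {u : EuclideanSpace ℝ (Fin n) × ℝ → ℝ}
    (hsub : GammaInfSub n (univ ×ˢ Ioo (0 : ℝ) T) u) (hu : ContinuousOn u (univ ×ˢ Ico (0 : ℝ) T))
    {M : ℝ} (hM : 0 < M) (hic : ∀ x, u (x, 0) ≤ M) {δ ε K : ℝ}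
    (hδ : 0 < δ) (hε : 0 < ε) (hδT : δ * (1 + T) ^ 2 ≤ 1 / 2)
    (hK : ∀ x : EuclideanSpace ℝ (Fin n), ∀ t : ℝ, 0 ≤ t → t ≤ T →
      u (x, t) ≤ Real.exp (δ / 2 * ((1 + ‖x‖ ^ 2) ^ ((2 : ℝ) / 3) + K)))
    (x : EuclideanSpace ℝ (Fin n)) {t : ℝ} (ht : t ∈ Ioo 0 T) :
    u (x, t) ≤ M * Real.exp (δ * (1 + t) * (1 + ‖x‖ ^ 2) ^ ((2 : ℝ) / 3) + ε) := by
  obtain ⟨ht0, htT⟩ := ht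
  obtain ⟨S, htS, hST⟩ := exists_between htT
  have hS0 : 0 < S := ht0.trans htS
  obtain ⟨N, hN⟩ := exists_le_mul_pow ((one_lt_div ht0).2 htS) hε (δ / 2 * K - Real.log M)
  set ρ : ℝ := max (max 1 ‖x‖) (K - 2 * Real.log M / δ) with hρ
  have hρ1 : 1 ≤ ρ := (le_max_left _ _).trans (le_max_left _ _)
  have hB := upperBarrier_pos n hM δ ε t N
  have hBexp : ∀ q : EuclideanSpace ℝ (Fin n) × ℝ, upperBarrier n M δ ε t N q =
      Real.exp (Real.log M + (δ * (1 + q.2) * (1 + ‖q.1‖ ^ 2) ^ ((2 : ℝ) / 3) +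
        ε * (q.2 / t) ^ N)) := by
    intro q
    rw [Real.exp_add, Real.exp_log hM, upperBarrier]
  have hval : upperBarrier n M δ ε t N (x, t) =
      M * Real.exp (δ * (1 + t) * (1 + ‖x‖ ^ 2) ^ ((2 : ℝ) / 3) + ε) := by
    simp [upperBarrier, div_self ht0.ne']
  rw [← hval]
  by_contra! hcon
  have hmul : ∀ (y : EuclideanSpace ℝ (Fin n)) (s : ℝ), 0 ≤ s →
      δ * (1 + ‖y‖ ^ 2) ^ ((2 : ℝ) / 3) ≤ δ * (1 + s) * (1 + ‖y‖ ^ 2) ^ ((2 : ℝ) / 3) := by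
    intro y s hs
    gcongr
    exact le_mul_of_one_le_right hδ.le (by linarith)
  have hcont : ContinuousOn (fun z => u z / upperBarrier n M δ ε t N z)
      (Metric.closedBall (0 : EuclideanSpace ℝ (Fin n)) ρ ×ˢ Icc 0 S) := by
    refine ContinuousOn.div (hu.mono ?_) (continuous_upperBarrier n M δ ε t N).continuousOn
      fun z _ => (hB z).ne'
    exact prod_mono (subset_univ _) fun s hs => ⟨hs.1, hs.2.trans_lt hST⟩
  have hlat : ∀ (y : EuclideanSpace ℝ (Fin n)) (s : ℝ), ‖y‖ = ρ → s ∈ Icc 0 S →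
      u (y, s) / upperBarrier n M δ ε t N (y, s) ≤ 1 := by
    intro y s hy hs
    refine (div_le_one (hB _)).2 ((hK y s hs.1 (hs.2.trans hST.le)).trans ?_)
    rw [hBexp]
    refine Real.exp_le_exp.2 ?_
    have h1 : ρ ≤ (1 + ‖y‖ ^ 2) ^ ((2 : ℝ) / 3) := by
      refine le_trans ?_ (norm_rpow_le y)
      rw [hy]
      exact Real.self_le_rpow_of_one_le hρ1 (by norm_num)
    have h2 : K - 2 * Real.log M / δ ≤ (1 + ‖y‖ ^ 2) ^ ((2 : ℝ) / 3) := (le_max_right _ _).trans h1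
    have h3 : δ / 2 * (K - 2 * Real.log M / δ) ≤ δ / 2 * (1 + ‖y‖ ^ 2) ^ ((2 : ℝ) / 3) := by gcongr
    have h4 : δ / 2 * (K - 2 * Real.log M / δ) = δ / 2 * K - Real.log M := by field_simp
    have h5 : 0 ≤ ε * (s / t) ^ N := by have := hs.1; positivity
    have h6 := hmul y s hs.1
    dsimp only
    linarith
  have hbot : ∀ y : EuclideanSpace ℝ (Fin n), ‖y‖ ≤ ρ →
      u (y, 0) / upperBarrier n M δ ε t N (y, 0) ≤ 1 := by
    intro y hy
    refine (div_le_one (hB _)).2 ((hic y).trans ?_)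
    refine le_mul_of_one_le_right hM.le (Real.one_le_exp ?_)
    dsimp only
    have : 0 ≤ ε * (0 / t) ^ N := by positivity
    positivity
  have htop : ∀ y : EuclideanSpace ℝ (Fin n), ‖y‖ ≤ ρ →
      u (y, S) / upperBarrier n M δ ε t N (y, S) ≤ 1 := by
    intro y hy
    refine (div_le_one (hB _)).2 ((hK y S hS0.le hST.le).trans ?_)
    rw [hBexp]
    refine Real.exp_le_exp.2 ?_
    have h6 := hmul y S hS0.le
    have h7 : 0 ≤ δ * (1 + ‖y‖ ^ 2) ^ ((2 : ℝ) / 3) := by positivity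
    dsimp only
    linarith
  obtain ⟨q, -, hq0, hqS, hq1, hqmax⟩ := exists_isLocalMax_cylinder hcont hlat hbot htop
    (q₀ := (x, t)) ⟨by simp [hρ], ht0.le, htS.le⟩ ((one_lt_div (hB _)).2 hcon)
  exact hsub.not_isLocalMax_div N hM hδ hε ht0 hδT ⟨hq0, hqS.trans hST⟩
    (one_pos.trans hq1) hqmax

/-- Positive supersolutions lie above the lower barrier. -/
lemma GammaInfSuper.mul_exp_le {n : ℕ} {T : ℝ} {u : EuclideanSpace ℝ (Fin n) × ℝ → ℝ}
    (hsuper : GammaInfSuper n (univ ×ˢ Ioo (0 : ℝ) T) u)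
    (hu : ContinuousOn u (univ ×ˢ Ico (0 : ℝ) T))
    (hupos : ∀ x, ∀ t ∈ Ico (0 : ℝ) T, 0 < u (x, t))
    {m : ℝ} (hm : 0 < m) (hic : ∀ x, m ≤ u (x, 0)) {R ε : ℝ} (hε : 0 < ε)
    {x : EuclideanSpace ℝ (Fin n)} (hx : ‖x‖ < R) {t : ℝ} (ht : t ∈ Ioo 0 T) :
    m * Real.exp (-(100 / R ^ 4 * t + ε)) * (1 - ‖x‖ ^ 2 / R ^ 2) ^ 2 ≤ u (x, t) := by
  obtain ⟨ht0, htT⟩ := ht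
  obtain ⟨S, htS, hST⟩ := exists_between htT
  have hS0 : 0 < S := ht0.trans htS
  have hR : 0 < R := (norm_nonneg x).trans_lt hx
  have hsubset : Metric.closedBall (0 : EuclideanSpace ℝ (Fin n)) R ×ˢ Icc 0 S ⊆
      univ ×ˢ Ico (0 : ℝ) T :=
    prod_mono (subset_univ _) fun s hs => ⟨hs.1, hs.2.trans_lt hST⟩
  have hupos' : ∀ q ∈ Metric.closedBall (0 : EuclideanSpace ℝ (Fin n)) R ×ˢ Icc 0 S, 0 < u q :=
    fun q hq => hupos q.1 q.2 (hsubset hq).2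
  obtain ⟨q₁, hq₁, hmin⟩ :=
    ((isCompact_closedBall (0 : EuclideanSpace ℝ (Fin n)) R).prod
      (isCompact_Icc (a := 0) (b := S))).exists_isMinOn
      ⟨(0, 0), by simp [hR.le], by simp [hS0.le]⟩ (hu.mono hsubset)
  obtain ⟨N, hN⟩ := exists_le_mul_pow ((one_lt_div ht0).2 htS) hε (Real.log m - Real.log (u q₁))
  have hC : 0 < m / R ^ 4 := by positivity
  have hval : lowerBarrier n (m / R ^ 4) R ε t N (x, t) =
      m * Real.exp (-(100 / R ^ 4 * t + ε)) * (1 - ‖x‖ ^ 2 / R ^ 2) ^ 2 := by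
    simp only [lowerBarrier, div_self ht0.ne', one_pow, mul_one]
    field_simp
  have hle : ∀ (y : EuclideanSpace ℝ (Fin n)) (s : ℝ), ‖y‖ ≤ R →
      lowerBarrier n (m / R ^ 4) R ε t N (y, s) ≤
        m * Real.exp (-(100 / R ^ 4 * s + ε * (s / t) ^ N)) := by
    intro y s hy
    have h1 : ‖y‖ ^ 2 ≤ R ^ 2 := by gcongr
    have h2 : (R ^ 2 - ‖y‖ ^ 2) ^ 2 ≤ (R ^ 2) ^ 2 := by
      have h3 : 0 ≤ R ^ 2 - ‖y‖ ^ 2 := by linarith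
      gcongr
      linarith [sq_nonneg ‖y‖]
    calc lowerBarrier n (m / R ^ 4) R ε t N (y, s)
        ≤ m / R ^ 4 * Real.exp (-(100 / R ^ 4 * s + ε * (s / t) ^ N)) * (R ^ 2) ^ 2 := by
          unfold lowerBarrier
          gcongr
      _ = m * Real.exp (-(100 / R ^ 4 * s + ε * (s / t) ^ N)) := by field_simp
  rw [← hval]
  by_contra! hcon
  have hxt : (x, t) ∈ Metric.closedBall (0 : EuclideanSpace ℝ (Fin n)) R ×ˢ Icc 0 S :=
    ⟨by simpa using hx.le, ht0.le, htS.le⟩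
  have hcont : ContinuousOn (fun z => lowerBarrier n (m / R ^ 4) R ε t N z / u z)
      (Metric.closedBall (0 : EuclideanSpace ℝ (Fin n)) R ×ˢ Icc 0 S) := by
    exact (continuous_lowerBarrier n _ R ε t N).continuousOn.div (hu.mono hsubset)
      fun z hz => (hupos' z hz).ne'
  have hlat : ∀ (y : EuclideanSpace ℝ (Fin n)) (s : ℝ), ‖y‖ = R → s ∈ Icc 0 S →
      lowerBarrier n (m / R ^ 4) R ε t N (y, s) / u (y, s) ≤ 1 := by
    intro y s hy hs
    simp [lowerBarrier, hy]
  have hbot : ∀ y : EuclideanSpace ℝ (Fin n), ‖y‖ ≤ R →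
      lowerBarrier n (m / R ^ 4) R ε t N (y, 0) / u (y, 0) ≤ 1 := by
    intro y hy
    have hy0 : (y, (0 : ℝ)) ∈ Metric.closedBall (0 : EuclideanSpace ℝ (Fin n)) R ×ˢ Icc 0 S :=
      ⟨by simpa using hy, le_rfl, hS0.le⟩
    refine (div_le_one (hupos' _ hy0)).2 ((hle y 0 hy).trans (le_trans ?_ (hic y)))
    refine mul_le_of_le_one_right hm.le (Real.exp_le_one_iff.2 ?_)
    have : 0 ≤ ε * (0 / t) ^ N := by positivity
    simpa using this
  have htop : ∀ y : EuclideanSpace ℝ (Fin n), ‖y‖ ≤ R →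
      lowerBarrier n (m / R ^ 4) R ε t N (y, S) / u (y, S) ≤ 1 := by
    intro y hy
    have hyS : (y, S) ∈ Metric.closedBall (0 : EuclideanSpace ℝ (Fin n)) R ×ˢ Icc 0 S :=
      ⟨by simpa using hy, hS0.le, le_rfl⟩
    refine (div_le_one (hupos' _ hyS)).2 ((hle y S hy).trans (le_trans ?_ (hmin hyS)))
    have h1 : 0 ≤ 100 / R ^ 4 * S := by positivity
    calc m * Real.exp (-(100 / R ^ 4 * S + ε * (S / t) ^ N))
        = Real.exp (Real.log m + -(100 / R ^ 4 * S + ε * (S / t) ^ N)) := by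
          rw [Real.exp_add, Real.exp_log hm]
      _ ≤ Real.exp (Real.log (u q₁)) := Real.exp_le_exp.2 (by linarith)
      _ = u q₁ := Real.exp_log (hupos' q₁ hq₁)
  obtain ⟨q, hqR, hq0, hqS, hq1, hqmax⟩ := exists_isLocalMax_cylinder hcont hlat hbot htop
    hxt ((one_lt_div (hupos' _ hxt)).2 hcon)
  exact hsuper.not_isLocalMax_div (fun y s hs => hupos y s (Ioo_subset_Ico_self hs)) N hC hR hε
    ht0 hqR ⟨hq0, hqS.trans hST⟩ (one_pos.trans hq1) hqmax

/-- Theorem 1.7 for `p = ∞`: a Phragmén–Lindelöf type result for `Γ_∞ u = Δ_∞ u − 3u²u_t = 0`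
in `ℝⁿ × (0,T)` under the growth condition `u ≤ exp(o(R^{4/3}))`. -/
theorem stmt4 (n : ℕ) (hn : 2 ≤ n) (T : ℝ) (hT : 0 < T)
    (f : EuclideanSpace ℝ (Fin n) → ℝ) (hf : Continuous f)
    (hfi : 0 < sInf (Set.range f)) (hfs : BddAbove (Set.range f))
    (u : EuclideanSpace ℝ (Fin n) × ℝ → ℝ)
    (hu : ContinuousOn u
      ((Set.univ ×ˢ {(0 : ℝ)}) ∪ (Set.univ ×ˢ Set.Ioo (0 : ℝ) T)))
    (hupos : ∀ q ∈ (Set.univ ×ˢ {(0 : ℝ)}) ∪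
      ((Set.univ : Set (EuclideanSpace ℝ (Fin n))) ×ˢ Set.Ioo (0 : ℝ) T), 0 < u q)
    (hsub : GammaInfSub n (Set.univ ×ˢ Set.Ioo (0 : ℝ) T) u)
    (hsuper : GammaInfSuper n (Set.univ ×ˢ Set.Ioo (0 : ℝ) T) u)
    (hic : ∀ x, u (x, 0) = f x)
    (hgrowth : ∀ ε > (0 : ℝ), ∃ R₀ : ℝ, ∀ R ≥ R₀, ∀ x : EuclideanSpace ℝ (Fin n), ∀ t : ℝ,
      ‖x‖ ≤ R → 0 ≤ t → t ≤ T → u (x, t) ≤ Real.exp (ε * R ^ ((4 : ℝ) / 3))) :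
    ∀ x : EuclideanSpace ℝ (Fin n), ∀ t ∈ Set.Ioo (0 : ℝ) T,
      sInf (Set.range f) ≤ u (x, t) ∧ u (x, t) ≤ sSup (Set.range f) := by
  have hdom : (univ ×ˢ {(0 : ℝ)}) ∪ ((univ : Set (EuclideanSpace ℝ (Fin n))) ×ˢ Ioo (0 : ℝ) T) =
      univ ×ˢ Ico (0 : ℝ) T := by
    rw [← prod_union, singleton_union, Ioo_insert_left hT]
  rw [hdom] at hu hupos
  have hbelow : BddBelow (range f) := by
    by_contra h
    rw [Real.sInf_of_not_bddBelow h] at hfi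
    exact lt_irrefl _ hfi
  have hsup : ∀ x, u (x, 0) ≤ sSup (range f) :=
    fun x => (hic x).trans_le (le_csSup hfs (mem_range_self x))
  have hinf : ∀ x, sInf (range f) ≤ u (x, 0) :=
    fun x => (csInf_le hbelow (mem_range_self x)).trans_eq (hic x).symm
  have hM : 0 < sSup (range f) := hfi.trans_le ((hinf 0).trans (hsup 0))
  intro x t ht
  have hpos : ∀ᶠ η : ℝ in nhdsWithin 0 (Ioi 0), 0 < η := eventually_mem_nhdsWithin
  constructor
  · have hlim : Tendsto (fun η : ℝ => sInf (range f) *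
        Real.exp (-(100 / η⁻¹ ^ 4 * t + η)) * (1 - ‖x‖ ^ 2 / η⁻¹ ^ 2) ^ 2)
        (nhdsWithin 0 (Ioi 0)) (nhds (sInf (range f))) := by
      have hc : Continuous fun η : ℝ => sInf (range f) *
          Real.exp (-(100 * η ^ 4 * t + η)) * (1 - ‖x‖ ^ 2 * η ^ 2) ^ 2 := by fun_prop
      have := (hc.tendsto 0).mono_left (nhdsWithin_le_nhds (s := Ioi 0))
      simpa [div_eq_mul_inv] using this
    have hsmall : ∀ᶠ η : ℝ in nhdsWithin 0 (Ioi 0), ‖x‖ * η < 1 :=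
      (((continuous_const.mul continuous_id).tendsto' (0 : ℝ) 0 (by simp)).mono_left
        nhdsWithin_le_nhds).eventually_lt_const one_pos
    refine le_of_tendsto hlim ?_
    filter_upwards [hpos, hsmall] with η hη hη'
    refine hsuper.mul_exp_le hu (fun y s hs => hupos _ ⟨mem_univ _, hs⟩) hfi hinf hη ?_ ht
    rwa [← one_div, lt_div_iff₀ hη]
  · have hlim : Tendsto (fun δ : ℝ => sSup (range f) *
        Real.exp (δ * (1 + t) * (1 + ‖x‖ ^ 2) ^ ((2 : ℝ) / 3) + δ))
        (nhdsWithin 0 (Ioi 0)) (nhds (sSup (range f))) := by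
      have hc : Continuous fun δ : ℝ => sSup (range f) *
        Real.exp (δ * (1 + t) * (1 + ‖x‖ ^ 2) ^ ((2 : ℝ) / 3) + δ) := by fun_prop
      have := (hc.tendsto 0).mono_left (nhdsWithin_le_nhds (s := Ioi 0))
      simpa using this
    have hsmall : ∀ᶠ δ : ℝ in nhdsWithin 0 (Ioi 0), δ * (1 + T) ^ 2 < 1 / 2 :=
      (((continuous_id.mul continuous_const).tendsto' (0 : ℝ) 0 (by simp)).mono_left
        nhdsWithin_le_nhds).eventually_lt_const (by norm_num)
    refine ge_of_tendsto hlim ?_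
    filter_upwards [hpos, hsmall] with δ hδ hδT
    obtain ⟨K, hK⟩ := exists_le_exp_of_growth (half_pos hδ) (hgrowth _ (half_pos hδ))
    exact hsub.le_mul_exp hu hM hsup hδ hδ hδT.le hK x ht
end
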